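/- arXiv:2003.05282 — 2 statements merged into one kernel-verified Lean document; each statement's English description precedes it below -/
import Mathlib

section
/- Let γ be the standard Gaussian measure on ℝⁿ, let K be an origin-symmetric convex body in ℝⁿ, and let t > 0. Then for every p ∈ (0,1] and every λ ∈ [0,1], γ(λ·K +_p (1−λ)·(tK))^{p/n} ≥ λ·γ(K)^{p/n} + (1−λ)·γ(tK)^{p/n}. -/
open MeasureTheory
open scoped RealInnerProductSpace ENNReal

noncomputable section

abbrev Euc (n : ℕ) : Type := EuclideanSpace ℝ (Fin n)

/-- A convex body: a compact convex set with nonempty interior. -/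
def IsConvexBody {n : ℕ} (K : Set (Euc n)) : Prop :=
  IsCompact K ∧ Convex ℝ K ∧ (interior K).Nonempty

/-- The support function `h_K(u) = sup_{y ∈ K} ⟨u, y⟩`. -/
def suppFn {n : ℕ} (K : Set (Euc n)) (u : Euc n) : ℝ :=
  sSup ((fun y => ⟪u, y⟫) '' K)

/-- `lpComb p lam K L` is the `L_p` combination `lam·K +_p (1−lam)·L`;
for `p = 0` it is the logarithmic combination. -/
def lpComb {n : ℕ} (p lam : ℝ) (K L : Set (Euc n)) : Set (Euc n) :=
  if p = 0 then
    {x | ∀ u : Euc n, ‖u‖ = 1 → ⟪x, u⟫ ≤ suppFn K u ^ lam * suppFn L u ^ (1 - lam)}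
  else
    {x | ∀ u : Euc n, ‖u‖ = 1 →
      ⟪x, u⟫ ≤ (lam * suppFn K u ^ p + (1 - lam) * suppFn L u ^ p) ^ (1 / p)}


/-- The standard Gaussian measure on `ℝⁿ`, with density `(2π)^{-n/2} e^{-|x|²/2}`. -/
def gaussianMeasure (n : ℕ) : Measure (Euc n) :=
  volume.withDensity fun x =>
    ENNReal.ofReal ((2 * Real.pi) ^ (-(n : ℝ) / 2) * Real.exp (-‖x‖ ^ 2 / 2))
open scoped Pointwise

/-- The one-dimensional Brunn–Minkowski inequality for midpoints. -/
theorem volume_add_volume_le_two_mul_of_midpoint_mem {A B C : Set ℝ} (hA : MeasurableSet A)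
    (hB : MeasurableSet B) (hA0 : A.Nonempty) (hB0 : B.Nonempty)
    (h : ∀ a ∈ A, ∀ b ∈ B, (a + b) / 2 ∈ C) : volume A + volume B ≤ 2 * volume C := by
  have hcompact : ∀ K L : Set ℝ, IsCompact K → IsCompact L → K.Nonempty → L.Nonempty →
      K ⊆ A → L ⊆ B → volume K + volume L ≤ 2 * volume C := by
    intro K L hK hL hK0 hL0 hKA hLB
    obtain ⟨b, hbK, hb⟩ := hK.exists_isGreatest hK0
    obtain ⟨a, haL, ha⟩ := hL.exists_isLeast hL0
    set D : Set ℝ := (fun z => (1 / 2 : ℝ) * z) ⁻¹' C with hD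
    have hDvol : volume D = 2 * volume C := by
      rw [hD, Real.volume_preimage_mul_left (by norm_num)]
      norm_num
    set U : Set ℝ := (fun x => x + a) '' K with hU
    set V : Set ℝ := (fun y => b + y) '' L with hV
    have hUvol : volume U = volume K := by
      rw [hU, Set.image_add_right, measure_preimage_add_right]
    have hVvol : volume V = volume L := by
      rw [hV, Set.image_add_left, measure_preimage_add]
    have hUV : U ∪ V ⊆ D := by
      rintro z (⟨x, hx, rfl⟩ | ⟨y, hy, rfl⟩)
      · have := h x (hKA hx) a (hLB haL)
        simpa [hD, div_eq_inv_mul] using this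
      · have := h b (hKA hbK) y (hLB hy)
        simpa [hD, div_eq_inv_mul] using this
    have hint : U ∩ V ⊆ {b + a} := by
      rintro z ⟨⟨x, hx, rfl⟩, ⟨y, hy, hxy⟩⟩
      have h1 := hb hx
      have h2 := ha hy
      simp only [Set.mem_singleton_iff] at hxy ⊢
      linarith
    have hint0 : volume (U ∩ V) = 0 := measure_mono_null hint (by simp)
    have hVm : MeasurableSet V := (hL.image (by fun_prop)).measurableSet
    rw [← hUvol, ← hVvol, ← measure_union_add_inter U hVm, hint0, add_zero, ← hDvol]
    exact measure_mono hUV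
  obtain ⟨a₀, ha₀⟩ := hA0
  obtain ⟨b₀, hb₀⟩ := hB0
  rw [hA.measure_eq_iSup_isCompact, hB.measure_eq_iSup_isCompact]
  simp only [iSup_and']
  refine ENNReal.biSup_add_biSup_le' ⟨∅, by simp⟩ ⟨∅, by simp⟩ ?_
  rintro K ⟨hKA, hK⟩ L ⟨hLB, hL⟩
  refine le_trans (add_le_add (measure_mono (Set.subset_insert a₀ K))
    (measure_mono (Set.subset_insert b₀ L))) ?_
  exact hcompact _ _ (hK.insert _) (hL.insert _) (Set.insert_nonempty _ _)
    (Set.insert_nonempty _ _) (Set.insert_subset ha₀ hKA) (Set.insert_subset hb₀ hLB)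

/-- The one-dimensional midpoint Prékopa–Leindler inequality in additive form, for functions with
supremum one. -/
theorem lintegral_add_lintegral_le_two_mul_of_mul_le_sq {F G H : ℝ → ℝ} (hF : Measurable F)
    (hG : Measurable G) (hH : Measurable H) (hF0 : ∀ x, 0 ≤ F x) (hG0 : ∀ x, 0 ≤ G x)
    (hH0 : ∀ x, 0 ≤ H x) (hF1 : ∀ x, F x ≤ 1) (hG1 : ∀ x, G x ≤ 1)
    (hFsup : ∀ τ < 1, ∃ x, τ < F x) (hGsup : ∀ τ < 1, ∃ x, τ < G x)
    (h : ∀ x y, F x * G y ≤ H ((x + y) / 2) ^ 2) :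
    (∫⁻ x, ENNReal.ofReal (F x)) + ∫⁻ x, ENNReal.ofReal (G x)
      ≤ 2 * ∫⁻ x, ENNReal.ofReal (H x) := by
  rw [lintegral_eq_lintegral_meas_lt volume (.of_forall hF0) hF.aemeasurable,
    lintegral_eq_lintegral_meas_lt volume (.of_forall hG0) hG.aemeasurable,
    lintegral_eq_lintegral_meas_lt volume (.of_forall hH0) hH.aemeasurable]
  have hanti : ∀ f : ℝ → ℝ, Measurable fun t : ℝ => volume {a : ℝ | t < f a} := fun f =>
    Antitone.measurable fun s t hst => measure_mono fun a (ha : t < f a) => lt_of_le_of_lt hst ha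
  rw [← lintegral_add_left (hanti F), ← lintegral_const_mul _ (hanti H)]
  refine setLIntegral_mono' measurableSet_Ioi fun t (ht : 0 < t) => ?_
  rcases lt_or_ge t 1 with ht1 | ht1
  · refine volume_add_volume_le_two_mul_of_midpoint_mem (measurableSet_lt measurable_const hF)
      (measurableSet_lt measurable_const hG) (hFsup t ht1) (hGsup t ht1) ?_
    intro a (ha : t < F a) b (hb : t < G b)
    have h1 := h a b
    show t < H ((a + b) / 2)
    refine lt_of_pow_lt_pow_left₀ 2 (hH0 _) ?_
    nlinarith
  · have e1 : {a | t < F a} = ∅ := by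
      ext a; simpa using (hF1 a).trans ht1
    have e2 : {a | t < G a} = ∅ := by
      ext a; simpa using (hG1 a).trans ht1
    simp [e1, e2]

theorem ENNReal.mul_le_sq_of_add_le_two_mul {a b c : ℝ≥0∞} (h : a + b ≤ 2 * c) :
    a * b ≤ c ^ 2 := by
  rcases eq_or_ne c ∞ with rfl | hc
  · simp
  have hfin : a + b ≠ ∞ := ne_top_of_le_ne_top (ENNReal.mul_ne_top (by simp) hc) h
  lift c to NNReal using hc
  lift a to NNReal using fun ha => hfin (by simp [ha])
  lift b to NNReal using fun hb => hfin (by simp [hb])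
  norm_cast at h ⊢
  have h' : (a : ℝ) + b ≤ 2 * c := by exact_mod_cast h
  have : (a : ℝ) * b ≤ c ^ 2 := by nlinarith [sq_nonneg ((a : ℝ) - b), a.2, b.2, c.2]
  exact_mod_cast this

theorem lintegral_mul_lintegral_le_sq_of_iSup_ne_top {f g h : ℝ → ℝ≥0∞} (hf : Measurable f)
    (hg : Measurable g) (hh : Measurable h) (hfsup : ⨆ x, f x ≠ ∞) (hgsup : ⨆ x, g x ≠ ∞)
    (hfgh : ∀ x y, f x * g y ≤ h ((x + y) / 2) ^ 2) :
    (∫⁻ x, f x) * ∫⁻ x, g x ≤ (∫⁻ x, h x) ^ 2 := by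
  set A := ⨆ x, f x with hA
  set B := ⨆ x, g x with hB
  rcases eq_or_ne A 0 with hA0 | hA0
  · have : ∀ x, f x = 0 := by simpa [hA] using hA0
    simp [this]
  rcases eq_or_ne B 0 with hB0 | hB0
  · have : ∀ x, g x = 0 := by simpa [hB] using hB0
    simp [this]
  obtain ⟨c, hc⟩ : ∃ c : ℝ≥0∞, c ^ 2 = A * B :=
    ⟨(A * B) ^ (1 / 2 : ℝ), by rw [← ENNReal.rpow_natCast, ← ENNReal.rpow_mul]; norm_num⟩
  have hAB0 : A * B ≠ 0 := mul_ne_zero hA0 hB0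
  have hABt : A * B ≠ ∞ := ENNReal.mul_ne_top hfsup hgsup
  have hc0 : c ≠ 0 := by rintro rfl; simp at hc; tauto
  have hct : c ≠ ∞ := by rintro rfl; exact hABt (by simpa using hc.symm)
  have hfA : ∀ x, f x / A ≤ 1 := fun x => ENNReal.div_le_of_le_mul (by simpa using le_iSup f x)
  have hgB : ∀ x, g x / B ≤ 1 := fun x => ENNReal.div_le_of_le_mul (by simpa using le_iSup g x)
  have hsup : ∀ (u : ℝ → ℝ≥0∞), ⨆ x, u x ≠ 0 → ⨆ x, u x ≠ ∞ → (∀ x, u x / (⨆ x, u x) ≤ 1) →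
      ∀ τ < (1 : ℝ), ∃ x, τ < (u x / ⨆ x, u x).toReal := by
    intro u h0 ht h1 τ hτ
    have hlt : ENNReal.ofReal τ * (⨆ x, u x) < ⨆ x, u x := by
      conv_rhs => rw [← one_mul (⨆ x, u x)]
      exact ENNReal.mul_lt_mul_left h0 ht (by simpa using hτ)
    obtain ⟨x, hx⟩ := lt_iSup_iff.1 hlt
    refine ⟨x, ?_⟩
    rcases lt_or_ge τ 0 with hneg | hnn
    · exact hneg.trans_le ENNReal.toReal_nonneg
    rw [← ENNReal.ofReal_lt_iff_lt_toReal hnn (ne_top_of_le_ne_top ENNReal.one_ne_top (h1 x))]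
    exact (ENNReal.lt_div_iff_mul_lt (.inl h0) (.inl ht)).2 hx
  have key := lintegral_add_lintegral_le_two_mul_of_mul_le_sq
    (F := fun x => (f x / A).toReal) (G := fun x => (g x / B).toReal)
    (H := fun x => (min (h x / c) 1).toReal)
    (hf.div_const A).ennreal_toReal (hg.div_const B).ennreal_toReal
    ((hh.div_const c).min measurable_const).ennreal_toReal
    (fun _ => ENNReal.toReal_nonneg) (fun _ => ENNReal.toReal_nonneg)
    (fun _ => ENNReal.toReal_nonneg)
    (fun x => ENNReal.toReal_mono ENNReal.one_ne_top (hfA x))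
    (fun x => ENNReal.toReal_mono ENNReal.one_ne_top (hgB x))
    (hsup f hA0 hfsup hfA) (hsup g hB0 hgsup hgB) ?_
  · have e1 : ∀ x, ENNReal.ofReal (f x / A).toReal = f x / A := fun x =>
      ENNReal.ofReal_toReal (ne_top_of_le_ne_top ENNReal.one_ne_top (hfA x))
    have e2 : ∀ x, ENNReal.ofReal (g x / B).toReal = g x / B := fun x =>
      ENNReal.ofReal_toReal (ne_top_of_le_ne_top ENNReal.one_ne_top (hgB x))
    have e3 : ∀ x, ENNReal.ofReal (min (h x / c) 1).toReal = min (h x / c) 1 := fun x =>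
      ENNReal.ofReal_toReal (ne_top_of_le_ne_top ENNReal.one_ne_top (min_le_right _ _))
    simp only [e1, e2, e3] at key
    have hH : ∫⁻ x, min (h x / c) 1 ≤ (∫⁻ x, h x) / c := by
      simp only [div_eq_mul_inv]
      rw [← lintegral_mul_const _ hh]
      exact lintegral_mono fun x => min_le_left _ _
    have hmul := ENNReal.mul_le_sq_of_add_le_two_mul key
    have hF : ∫⁻ x, f x / A = (∫⁻ x, f x) / A := by
      simp only [div_eq_mul_inv]; rw [lintegral_mul_const _ hf]
    have hG : ∫⁻ x, g x / B = (∫⁻ x, g x) / B := by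
      simp only [div_eq_mul_inv]; rw [lintegral_mul_const _ hg]
    rw [hF, hG] at hmul
    calc (∫⁻ x, f x) * ∫⁻ x, g x
        = (A * B) * ((∫⁻ x, f x) / A * ((∫⁻ x, g x) / B)) := by
          rw [mul_mul_mul_comm, ENNReal.mul_div_cancel hA0 hfsup, ENNReal.mul_div_cancel hB0 hgsup]
      _ ≤ c ^ 2 * ((∫⁻ x, h x) / c) ^ 2 := by
          rw [hc]; gcongr; exact hmul.trans (by gcongr)
      _ = (∫⁻ x, h x) ^ 2 := by
          rw [← mul_pow, ENNReal.mul_div_cancel hc0 hct]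
  · intro x y
    rw [← ENNReal.toReal_mul, ← ENNReal.toReal_pow]
    refine ENNReal.toReal_mono (ENNReal.pow_ne_top
      (ne_top_of_le_ne_top ENNReal.one_ne_top (min_le_right _ _))) ?_
    rcases min_choice (h ((x + y) / 2) / c) 1 with hm | hm
    · rw [hm]
      calc f x / A * (g y / B) = (f x * g y) / (A * B) := by
            simp only [div_eq_mul_inv]
            rw [ENNReal.mul_inv (.inl hA0) (.inl hfsup)]; ring
        _ ≤ h ((x + y) / 2) ^ 2 / c ^ 2 := by rw [hc]; gcongr; exact hfgh x y
        _ = (h ((x + y) / 2) / c) ^ 2 := by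
            simp only [div_eq_mul_inv]; rw [mul_pow, ENNReal.inv_pow]
    · rw [hm, one_pow]; exact mul_le_one' (hfA x) (hgB y)

/-- The midpoint case of the Prékopa–Leindler inequality on the real line. -/
theorem prekopa_leindler_real {f g h : ℝ → ℝ≥0∞} (hf : Measurable f)
    (hg : Measurable g) (hh : Measurable h)
    (hfgh : ∀ x y, f x * g y ≤ h ((x + y) / 2) ^ 2) :
    (∫⁻ x, f x) * ∫⁻ x, g x ≤ (∫⁻ x, h x) ^ 2 := by
  have htrunc : ∀ u : ℝ → ℝ≥0∞, Measurable u →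
      ∫⁻ x, u x = ⨆ N : ℕ, ∫⁻ x, min (u x) N := by
    intro u hu
    rw [← lintegral_iSup (fun N => hu.min measurable_const)
      (fun N M hNM x => min_le_min le_rfl (by exact_mod_cast hNM))]
    congr 1 with x
    refine le_antisymm ?_ (iSup_le fun N => min_le_left _ _)
    rw [← inf_iSup_eq, ENNReal.iSup_natCast]; simp
  rw [htrunc f hf, htrunc g hg, ENNReal.iSup_mul]
  refine iSup_le fun N => ?_
  rw [ENNReal.mul_iSup]
  refine iSup_le fun M => ?_
  have hb : ∀ (u : ℝ → ℝ≥0∞) (N : ℕ), ⨆ x, min (u x) (N : ℝ≥0∞) ≠ ∞ := fun u N =>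
    ne_top_of_le_ne_top (ENNReal.natCast_ne_top N) (iSup_le fun x => min_le_right _ _)
  refine lintegral_mul_lintegral_le_sq_of_iSup_ne_top (hf.min measurable_const)
    (hg.min measurable_const) hh (hb f N) (hb g M) fun x y => ?_
  exact le_trans (mul_le_mul' (min_le_left _ _) (min_le_left _ _)) (hfgh x y)

/-- The midpoint case of the Prékopa–Leindler inequality on `ℝⁿ`. -/
theorem prekopa_leindler_pi (n : ℕ) {f g h : (Fin n → ℝ) → ℝ≥0∞} (hf : Measurable f)
    (hg : Measurable g) (hh : Measurable h)
    (hfgh : ∀ x y, f x * g y ≤ h ((1 / 2 : ℝ) • (x + y)) ^ 2) :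
    (∫⁻ x, f x) * ∫⁻ x, g x ≤ (∫⁻ x, h x) ^ 2 := by
  induction n with
  | zero =>
    have hv : (volume : Measure (Fin 0 → ℝ)) = Measure.dirac 0 := by
      rw [volume_pi]; exact Measure.pi_of_empty _ _
    rw [hv, lintegral_dirac' _ hf, lintegral_dirac' _ hg, lintegral_dirac' _ hh]
    simpa using hfgh 0 0
  | succ n ih =>
    have hfun : ⇑(MeasurableEquiv.piFinSuccAbove (fun _ : Fin (n + 1) => ℝ) 0).symm
        = fun p : ℝ × (Fin n → ℝ) => (Fin.cons p.1 p.2 : Fin (n + 1) → ℝ) := by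
      ext p i
      simp [MeasurableEquiv.piFinSuccAbove, Fin.insertNthEquiv]
    have hcons : ∀ u : (Fin (n + 1) → ℝ) → ℝ≥0∞, Measurable u →
        ∫⁻ x, u x = ∫⁻ s : ℝ, ∫⁻ y : Fin n → ℝ, u (Fin.cons s y) := by
      intro u hu
      have hmp := (volume_preserving_piFinSuccAbove (fun _ : Fin (n + 1) => ℝ) 0).symm
      rw [← hmp.lintegral_comp hu, Measure.volume_eq_prod, lintegral_prod]
      · simp only [hfun]
      · exact (hu.comp hmp.measurable).aemeasurable
    have hmeas : Measurable fun p : ℝ × (Fin n → ℝ) => (Fin.cons p.1 p.2 : Fin (n + 1) → ℝ) := by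
      rw [← hfun]
      exact (MeasurableEquiv.piFinSuccAbove (fun _ : Fin (n + 1) => ℝ) 0).symm.measurable
    rw [hcons f hf, hcons g hg, hcons h hh]
    refine prekopa_leindler_real (hf.comp hmeas).lintegral_prod_right'
      (hg.comp hmeas).lintegral_prod_right' (hh.comp hmeas).lintegral_prod_right' fun s t => ?_
    have hc : ∀ s : ℝ, Measurable fun y : Fin n → ℝ => (Fin.cons s y : Fin (n + 1) → ℝ) :=
      fun s => hmeas.comp measurable_prodMk_left
    refine ih (hf.comp (hc s)) (hg.comp (hc t)) (hh.comp (hc ((s + t) / 2))) fun x y => ?_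
    refine (hfgh (Fin.cons s x) (Fin.cons t y)).trans_eq ?_
    congr 2
    ext i
    refine Fin.cases ?_ (fun j => ?_) i
    · simp; ring
    · simp; ring

/-- The midpoint case of the Prékopa–Leindler inequality on Euclidean space. -/
theorem prekopa_leindler {n : ℕ} {f g h : Euc n → ℝ≥0∞} (hf : Measurable f)
    (hg : Measurable g) (hh : Measurable h)
    (hfgh : ∀ x y, f x * g y ≤ h ((1 / 2 : ℝ) • (x + y)) ^ 2) :
    (∫⁻ x, f x) * ∫⁻ x, g x ≤ (∫⁻ x, h x) ^ 2 := by
  have hmp := PiLp.volume_preserving_toLp (Fin n)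
  rw [← hmp.lintegral_comp hf, ← hmp.lintegral_comp hg, ← hmp.lintegral_comp hh]
  exact prekopa_leindler_pi n (hf.comp hmp.measurable) (hg.comp hmp.measurable)
    (hh.comp hmp.measurable) fun x y => hfgh _ _

/-- A Gaussian restricted to a symmetric convex set is sub-Gaussian with at most the original
variance. -/
theorem setLIntegral_exp_sub_inner_le {n : ℕ} {C : Set (Euc n)} (hCm : MeasurableSet C)
    (hC : Convex ℝ C) (hsym : ∀ x ∈ C, -x ∈ C) {a : ℝ} (ha : 0 < a) (w : Euc n) :
    ∫⁻ u in C, ENNReal.ofReal (Real.exp (-a * ‖u‖ ^ 2 / 2 - ⟪u, w⟫))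
      ≤ ENNReal.ofReal (Real.exp (‖w‖ ^ 2 / (2 * a)))
        * ∫⁻ u in C, ENNReal.ofReal (Real.exp (-a * ‖u‖ ^ 2 / 2)) := by
  set f : Euc n → ℝ≥0∞ :=
    C.indicator fun u => ENNReal.ofReal (Real.exp (-a * ‖u‖ ^ 2 / 2 - ⟪u, w⟫)) with hf
  set g : Euc n → ℝ≥0∞ :=
    C.indicator fun u => ENNReal.ofReal (Real.exp (-a * ‖u‖ ^ 2 / 2 + ⟪u, w⟫)) with hg
  set h : Euc n → ℝ≥0∞ := C.indicator fun u => ENNReal.ofReal (Real.exp (‖w‖ ^ 2 / (2 * a))) *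
    ENNReal.ofReal (Real.exp (-a * ‖u‖ ^ 2 / 2)) with hh
  have hfm : Measurable f := Measurable.indicator (by fun_prop) hCm
  have hgm : Measurable g := Measurable.indicator (by fun_prop) hCm
  have hhm : Measurable h := Measurable.indicator (by fun_prop) hCm
  have hfg : ∫⁻ x, g x = ∫⁻ x, f x := by
    rw [← (Measure.measurePreserving_neg (volume : Measure (Euc n))).lintegral_comp hfm]
    congr 1 with x
    have hx : -x ∈ C ↔ x ∈ C := ⟨fun hx => by simpa using hsym _ hx, hsym x⟩
    by_cases hxC : x ∈ C
    · simp [hf, hg, hxC, hx.2 hxC]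
    · simp [hf, hg, hxC, hx]
  have key := prekopa_leindler hfm hgm hhm ?_
  · rw [hfg, ← sq, ENNReal.pow_le_pow_left_iff two_ne_zero] at key
    rw [hf, hh, lintegral_indicator hCm, lintegral_indicator hCm,
      lintegral_const_mul _ (by fun_prop)] at key
    exact key
  · intro x y
    by_cases hx : x ∈ C
    swap
    · simp [hf, hx]
    by_cases hy : y ∈ C
    swap
    · simp [hg, hy]
    have hxy : (1 / 2 : ℝ) • (x + y) ∈ C := by
      rw [smul_add]; exact hC hx hy (by norm_num) (by norm_num) (by norm_num)
    simp only [hf, hg, hh, Set.indicator_of_mem hx, Set.indicator_of_mem hy,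
      Set.indicator_of_mem hxy]
    rw [← ENNReal.ofReal_mul (Real.exp_nonneg _), ← ENNReal.ofReal_mul (Real.exp_nonneg _),
      ← ENNReal.ofReal_pow (by positivity), ← Real.exp_add, ← Real.exp_add, ← Real.exp_nat_mul]
    refine ENNReal.ofReal_le_ofReal (Real.exp_le_exp.2 ?_)
    have h1 : ‖(1 / 2 : ℝ) • (x + y)‖ ^ 2 = (‖x‖ ^ 2 + 2 * ⟪x, y⟫ + ‖y‖ ^ 2) / 4 := by
      rw [norm_smul, mul_pow, norm_add_sq_real]; norm_num; ring
    have h2 : 0 ≤ ‖a • (x - y) + (2 : ℝ) • w‖ ^ 2 := by positivity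
    rw [norm_add_sq_real, norm_smul, norm_smul, mul_pow, mul_pow, norm_sub_sq_real,
      inner_smul_left, inner_smul_right, inner_sub_left] at h2
    simp only [Real.norm_eq_abs, sq_abs, RCLike.conj_to_real] at h2
    rw [h1, ← sub_nonneg]
    have h3 : ((2 : ℕ) : ℝ) * (‖w‖ ^ 2 / (2 * a) + -a * ((‖x‖ ^ 2 + 2 * ⟪x, y⟫ + ‖y‖ ^ 2) / 4) / 2)
        - (-a * ‖x‖ ^ 2 / 2 - ⟪x, w⟫ + (-a * ‖y‖ ^ 2 / 2 + ⟪y, w⟫))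
        = (a ^ 2 * (‖x‖ ^ 2 - 2 * ⟪x, y⟫ + ‖y‖ ^ 2) + 2 * (a * (2 * (⟪x, w⟫ - ⟪y, w⟫)))
          + 2 ^ 2 * ‖w‖ ^ 2) / (4 * a) := by
      push_cast; field_simp; ring
    rw [h3]
    positivity

/-- The rotation `(u, v) ↦ ((u + v) / √2, (u - v) / √2)`. -/
def hadamardMap (n : ℕ) : (Euc n × Euc n) →ₗ[ℝ] (Euc n × Euc n) :=
  ((√2)⁻¹ : ℝ) • (LinearMap.fst ℝ _ _ + LinearMap.snd ℝ _ _).prod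
    (LinearMap.fst ℝ _ _ - LinearMap.snd ℝ _ _)

theorem hadamardMap_apply {n : ℕ} (p : Euc n × Euc n) :
    hadamardMap n p = ((√2)⁻¹ • (p.1 + p.2), (√2)⁻¹ • (p.1 - p.2)) := rfl

theorem hadamardMap_hadamardMap {n : ℕ} (p : Euc n × Euc n) :
    hadamardMap n (hadamardMap n p) = p := by
  have h : (√2)⁻¹ * (√2)⁻¹ * (2 : ℝ) = 1 := by
    rw [← mul_inv, Real.mul_self_sqrt (by norm_num)]; norm_num
  ext1 <;> simp only [hadamardMap_apply]
  · rw [← smul_add, smul_smul, show p.1 + p.2 + (p.1 - p.2) = (2 : ℝ) • p.1 by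
      rw [two_smul]; abel, smul_smul, h, one_smul]
  · rw [← smul_sub, smul_smul, show p.1 + p.2 - (p.1 - p.2) = (2 : ℝ) • p.2 by
      rw [two_smul]; abel, smul_smul, h, one_smul]

theorem measurable_hadamardMap (n : ℕ) : Measurable (hadamardMap n) :=
  (LinearMap.continuous_of_finiteDimensional _).measurable

theorem measurePreserving_hadamardMap (n : ℕ) : MeasurePreserving (hadamardMap n) := by
  refine ⟨measurable_hadamardMap n, ?_⟩
  have hsq : LinearMap.det (hadamardMap n) * LinearMap.det (hadamardMap n) = 1 := by
    rw [← LinearMap.det_comp, show hadamardMap n ∘ₗ hadamardMap n = LinearMap.id from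
      LinearMap.ext hadamardMap_hadamardMap, LinearMap.det_id]
  have habs : |LinearMap.det (hadamardMap n)| = 1 := by
    rw [← sq_eq_sq₀ (abs_nonneg _) zero_le_one, sq_abs, sq, hsq, one_pow]
  have : (volume : Measure (Euc n × Euc n)).IsAddHaarMeasure := by
    rw [Measure.volume_eq_prod]; infer_instance
  rw [Measure.map_linearMap_addHaar_eq_smul_addHaar _ (by intro h; simp [h] at hsq), abs_inv, habs]
  simp

theorem setLIntegral_prod_eq_lintegral_section {n : ℕ} {S : Set (Euc n × Euc n)}
    (hS : MeasurableSet S) {F : Euc n × Euc n → ℝ≥0∞} (hF : Measurable F) :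
    ∫⁻ p in S, F p = ∫⁻ v, ∫⁻ u in {u | (u, v) ∈ S}, F (u, v) := by
  rw [← lintegral_indicator hS, Measure.volume_eq_prod,
    lintegral_prod_symm _ (hF.indicator hS).aemeasurable]
  congr 1 with v
  exact lintegral_indicator (measurable_prodMk_right hS) (fun u => F (u, v))

/-- If the rotated sections of `T` are symmetric and convex, rotating `T` and replacing the weights
`a, b` by their arithmetic and harmonic means does not decrease the Gaussian integral. -/
theorem setLIntegral_gaussian_pair_le {n : ℕ} {T : Set (Euc n × Euc n)} (hT : MeasurableSet T)
    (hconv : ∀ v, Convex ℝ {u | hadamardMap n (u, v) ∈ T})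
    (hsym : ∀ v u, hadamardMap n (u, v) ∈ T → hadamardMap n (-u, v) ∈ T)
    {a b : ℝ} (ha : 0 < a) (hb : 0 < b) :
    ∫⁻ p in T, ENNReal.ofReal (Real.exp (-a * ‖p.1‖ ^ 2 / 2 - b * ‖p.2‖ ^ 2 / 2))
      ≤ ∫⁻ p in hadamardMap n ⁻¹' T, ENNReal.ofReal
          (Real.exp (-((a + b) / 2) * ‖p.1‖ ^ 2 / 2
            - (a * b / ((a + b) / 2)) * ‖p.2‖ ^ 2 / 2)) := by
  have hS : MeasurableSet (hadamardMap n ⁻¹' T) := measurable_hadamardMap n hT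
  rw [← (measurePreserving_hadamardMap n).setLIntegral_comp_preimage hT (by fun_prop),
    setLIntegral_prod_eq_lintegral_section hS
      (F := fun p => ENNReal.ofReal (Real.exp (-a * ‖(hadamardMap n p).1‖ ^ 2 / 2
        - b * ‖(hadamardMap n p).2‖ ^ 2 / 2)))
      (by have := measurable_hadamardMap n; fun_prop),
    setLIntegral_prod_eq_lintegral_section hS (by fun_prop)]
  refine lintegral_mono fun v => ?_
  have hA : 0 < (a + b) / 2 := by positivity
  have hSv : MeasurableSet {u | (u, v) ∈ hadamardMap n ⁻¹' T} := measurable_prodMk_right hS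
  have key := setLIntegral_exp_sub_inner_le hSv (hconv v) (fun u hu => hsym v u hu) hA
    (((a - b) / 2) • v)
  have hsq : ((√2)⁻¹ : ℝ) ^ 2 = 1 / 2 := by rw [inv_pow, Real.sq_sqrt (by norm_num)]; norm_num
  have e1 : ∀ u : Euc n, ENNReal.ofReal (Real.exp (-a * ‖(hadamardMap n (u, v)).1‖ ^ 2 / 2
        - b * ‖(hadamardMap n (u, v)).2‖ ^ 2 / 2))
      = ENNReal.ofReal (Real.exp (-((a + b) / 2) * ‖v‖ ^ 2 / 2)) * ENNReal.ofReal
        (Real.exp (-((a + b) / 2) * ‖u‖ ^ 2 / 2 - ⟪u, ((a - b) / 2) • v⟫)) := by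
    intro u
    rw [← ENNReal.ofReal_mul (Real.exp_nonneg _), ← Real.exp_add]
    congr 2
    simp only [hadamardMap_apply, norm_smul, mul_pow, norm_add_sq_real, norm_sub_sq_real,
      Real.norm_eq_abs, sq_abs, hsq, inner_smul_right]
    ring
  have e2 : ∀ u : Euc n, ENNReal.ofReal (Real.exp (-((a + b) / 2) * ‖u‖ ^ 2 / 2
        - (a * b / ((a + b) / 2)) * ‖v‖ ^ 2 / 2))
      = ENNReal.ofReal (Real.exp (-((a + b) / 2) * ‖v‖ ^ 2 / 2)) * (ENNReal.ofReal
        (Real.exp (‖((a - b) / 2) • v‖ ^ 2 / (2 * ((a + b) / 2))))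
        * ENNReal.ofReal (Real.exp (-((a + b) / 2) * ‖u‖ ^ 2 / 2))) := by
    intro u
    rw [← ENNReal.ofReal_mul (Real.exp_nonneg _), ← ENNReal.ofReal_mul (Real.exp_nonneg _),
      ← Real.exp_add, ← Real.exp_add]
    congr 2
    simp only [norm_smul, mul_pow, Real.norm_eq_abs, sq_abs]
    field_simp
    ring
  simp only [e1, e2]
  rw [lintegral_const_mul _ (by fun_prop), lintegral_const_mul _ (by fun_prop),
    lintegral_const_mul _ (by fun_prop)]
  gcongr

/-- The Gaussian integral `∫_K exp(-a|x|²/2) dx`. -/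
def gaussInt {n : ℕ} (K : Set (Euc n)) (a : ℝ) : ℝ≥0∞ :=
  ∫⁻ x in K, ENNReal.ofReal (Real.exp (-a * ‖x‖ ^ 2 / 2))

theorem gaussInt_mul_gaussInt {n : ℕ} (K : Set (Euc n)) (a b : ℝ) :
    gaussInt K a * gaussInt K b = ∫⁻ p in K ×ˢ K,
      ENNReal.ofReal (Real.exp (-a * ‖p.1‖ ^ 2 / 2 - b * ‖p.2‖ ^ 2 / 2)) := by
  rw [Measure.volume_eq_prod, ← Measure.prod_restrict, gaussInt, gaussInt,
    ← lintegral_prod_mul (by fun_prop) (by fun_prop)]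
  congr 1 with p
  rw [← ENNReal.ofReal_mul (Real.exp_nonneg _), ← Real.exp_add]
  congr 2
  ring

theorem gaussInt_mul_gaussInt_le_means {n : ℕ} {K : Set (Euc n)} (hKm : MeasurableSet K)
    (hK : Convex ℝ K) (hsym : ∀ x ∈ K, -x ∈ K) {a b : ℝ} (ha : 0 < a) (hb : 0 < b) :
    ∃ a' b' : ℝ, 0 < a' ∧ 0 < b' ∧ a' * b' = a * b ∧ |a' - b'| ≤ |a - b| / 2 ∧
      gaussInt K a * gaussInt K b ≤ gaussInt K a' * gaussInt K b' := by
  have hmean : ∀ a b : ℝ, 0 < a → 0 < b → 0 < (a + b) / 2 ∧ 0 < a * b / ((a + b) / 2) ∧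
      (a + b) / 2 * (a * b / ((a + b) / 2)) = a * b ∧
      |(a + b) / 2 - a * b / ((a + b) / 2)| ≤ |a - b| / 2 := by
    intro a b ha hb
    refine ⟨by positivity, by positivity, by field_simp, ?_⟩
    have h1 : (a + b) / 2 - a * b / ((a + b) / 2) = |a - b| * |a - b| / (2 * (a + b)) := by
      rw [abs_mul_abs_self]; field_simp; ring
    have h2 : |a - b| ≤ a + b := abs_sub_le_iff.2 ⟨by linarith, by linarith⟩
    rw [h1, abs_of_nonneg (by positivity), div_le_div_iff₀ (by positivity) (by norm_num)]
    nlinarith [abs_nonneg (a - b)]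
  obtain ⟨hA, hH, hAH, hd⟩ := hmean a b ha hb
  obtain ⟨hA', hH', hAH', hd'⟩ := hmean _ _ hA hH
  refine ⟨_, _, hA', hH', hAH'.trans hAH, hd'.trans ?_, ?_⟩
  · linarith [abs_nonneg (a - b)]
  have hR : hadamardMap n ⁻¹' (hadamardMap n ⁻¹' K ×ˢ K) = K ×ˢ K := by
    ext p; simp only [Set.mem_preimage, hadamardMap_hadamardMap]
  have hKK : MeasurableSet (K ×ˢ K) := hKm.prod hKm
  rw [gaussInt_mul_gaussInt, gaussInt_mul_gaussInt]
  refine (setLIntegral_gaussian_pair_le hKK ?_ ?_ ha hb).trans ?_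
  · intro v x hx y hy s t hs ht hst
    have hcomb : hadamardMap n (s • x + t • y, v)
        = s • hadamardMap n (x, v) + t • hadamardMap n (y, v) := by
      rw [← map_smul, ← map_smul, ← map_add]
      congr 1
      ext1
      · rfl
      · simp [← add_smul, hst]
    show hadamardMap n (s • x + t • y, v) ∈ K ×ˢ K
    rw [hcomb]
    exact (hK.prod hK) hx hy hs ht hst
  · rintro v u ⟨h1, h2⟩
    simp only [hadamardMap_apply] at h1 h2
    refine ⟨?_, ?_⟩ <;> simp only [hadamardMap_apply]
    · convert hsym _ h2 using 1
      rw [← smul_neg]; congr 1; abel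
    · convert hsym _ h1 using 1
      rw [← smul_neg]; congr 1; abel
  refine (setLIntegral_gaussian_pair_le (measurable_hadamardMap n hKK) ?_ ?_ hA hH).trans ?_
  · intro v
    simp only [Set.mem_preimage, hadamardMap_hadamardMap]
    intro x hx y hy s t hs ht hst
    exact ⟨hK hx.1 hy.1 hs ht hst, hx.2⟩
  · intro v u h
    simp only [Set.mem_preimage, hadamardMap_hadamardMap] at h ⊢
    exact ⟨hsym _ h.1, h.2⟩
  · rw [hR]

/-- A continuous midpoint-concave function is concave. -/
theorem Continuous.concave_of_midpoint {g : ℝ → ℝ} (hg : Continuous g)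
    (hmid : ∀ x y, g x + g y ≤ 2 * g ((x + y) / 2)) (x y : ℝ) {l : ℝ} (hl : l ∈ Set.Icc (0 : ℝ) 1) :
    l * g x + (1 - l) * g y ≤ g (l * x + (1 - l) * y) := by
  set ψ : ℝ → ℝ := fun s => g (s * x + (1 - s) * y) - (s * g x + (1 - s) * g y) with hψ
  have hψc : Continuous ψ := by fun_prop
  obtain ⟨m, hm, hmin⟩ := isCompact_Icc.exists_isMinOn ⟨l, hl⟩ hψc.continuousOn
  have hmle : ∀ s ∈ Set.Icc (0 : ℝ) 1, ψ m ≤ ψ s := fun s hs => hmin hs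
  have hψmid : ∀ s s', ψ s + ψ s' ≤ 2 * ψ ((s + s') / 2) := by
    intro s s'
    have := hmid (s * x + (1 - s) * y) (s' * x + (1 - s') * y)
    rw [show (s * x + (1 - s) * y + (s' * x + (1 - s') * y)) / 2
      = (s + s') / 2 * x + (1 - (s + s') / 2) * y by ring] at this
    simp only [hψ]
    linarith
  have h0 : ψ 0 = 0 := by simp [hψ]
  have h1 : ψ 1 = 0 := by simp [hψ]
  have hnonneg : 0 ≤ ψ m := by
    rcases le_total m (1 / 2) with h | h
    · have e1 := hψmid 0 (2 * m)
      have e2 := hmle (2 * m) ⟨by linarith [hm.1], by linarith⟩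
      rw [h0, show (0 + 2 * m) / 2 = m by ring] at e1
      linarith
    · have e1 := hψmid (2 * m - 1) 1
      have e2 := hmle (2 * m - 1) ⟨by linarith, by linarith [hm.2]⟩
      rw [h1, show (2 * m - 1 + 1) / 2 = m by ring] at e1
      linarith
  have := hnonneg.trans (hmle l hl)
  simp only [hψ] at this
  linarith

/-- If `φ` is concave with slopes in `[0, 1]`, then `r ↦ exp (φ (log r))` is concave on `(0, ∞)`. -/
theorem concave_exp_comp_log {φ : ℝ → ℝ}
    (hconc : ∀ x y, ∀ l ∈ Set.Icc (0 : ℝ) 1, l * φ x + (1 - l) * φ y ≤ φ (l * x + (1 - l) * y))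
    (hmono : Monotone φ) (hanti : Antitone fun x => φ x - x) {r₁ r₂ : ℝ} (hr₁ : 0 < r₁)
    (hr₂ : 0 < r₂) {l : ℝ} (hl : l ∈ Set.Icc (0 : ℝ) 1) :
    l * Real.exp (φ (Real.log r₁)) + (1 - l) * Real.exp (φ (Real.log r₂))
      ≤ Real.exp (φ (Real.log (l * r₁ + (1 - l) * r₂))) := by
  rcases eq_or_ne r₁ r₂ with rfl | hne
  · exact le_of_eq (by rw [show l * r₁ + (1 - l) * r₁ = r₁ by ring]; ring)
  rcases eq_or_lt_of_le hl.1 with rfl | hl0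
  · simp
  rcases eq_or_lt_of_le hl.2 with rfl | hl1
  · simp
  set r₀ := l * r₁ + (1 - l) * r₂ with hr₀
  have hr₀pos : 0 < r₀ := by have := sub_pos.2 hl1; positivity
  set x₁ := Real.log r₁ with hx₁
  set x₂ := Real.log r₂ with hx₂
  set x₀ := Real.log r₀ with hx₀
  have hbetween : (x₁ < x₀ ∧ x₀ < x₂) ∨ (x₂ < x₀ ∧ x₀ < x₁) := by
    rcases lt_or_gt_of_ne hne with h | h
    · left
      exact ⟨Real.log_lt_log hr₁ (by nlinarith), Real.log_lt_log hr₀pos (by nlinarith)⟩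
    · right
      exact ⟨Real.log_lt_log hr₂ (by nlinarith), Real.log_lt_log hr₀pos (by nlinarith)⟩
  have hx20 : x₂ - x₀ ≠ 0 := by rcases hbetween with h | h <;> intro h' <;> linarith [h.1, h.2]
  have hx21 : x₂ - x₁ ≠ 0 := by rcases hbetween with h | h <;> intro h' <;> linarith [h.1, h.2]
  set k := (φ x₂ - φ x₀) / (x₂ - x₀) with hk
  have hk2 : φ x₂ = φ x₀ + k * (x₂ - x₀) := by rw [hk, div_mul_cancel₀ _ hx20]; ring
  have hk01 : 0 ≤ k ∧ k ≤ 1 := by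
    rcases hbetween with h | h
    · have e1 := hmono h.2.le
      have e2 : φ x₂ - x₂ ≤ φ x₀ - x₀ := hanti h.2.le
      have e3 : 0 < x₂ - x₀ := sub_pos.2 h.2
      exact ⟨div_nonneg (by linarith) e3.le, (div_le_one e3).2 (by linarith)⟩
    · have e1 := hmono h.1.le
      have e2 : φ x₀ - x₀ ≤ φ x₂ - x₂ := hanti h.1.le
      have e3 : x₂ - x₀ < 0 := sub_neg.2 h.1
      exact ⟨div_nonneg_of_nonpos (by linarith) e3.le, (div_le_one_of_neg e3).2 (by linarith)⟩
  set μ := (x₂ - x₀) / (x₂ - x₁) with hμ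
  have hμx : μ * (x₂ - x₁) = x₂ - x₀ := by rw [hμ, div_mul_cancel₀ _ hx21]
  have hμ01 : 0 < μ ∧ μ ≤ 1 := by
    rcases hbetween with h | h
    · have e : 0 < x₂ - x₁ := by linarith [h.1, h.2]
      exact ⟨div_pos (by linarith [h.2]) e, (div_le_one e).2 (by linarith [h.1])⟩
    · have e : x₂ - x₁ < 0 := by linarith [h.1, h.2]
      exact ⟨div_pos_of_neg_of_neg (by linarith [h.1]) e,
        (div_le_one_of_neg e).2 (by linarith [h.2])⟩
  have hk1 : φ x₁ ≤ φ x₀ + k * (x₁ - x₀) := by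
    have hc := hconc x₁ x₂ μ ⟨hμ01.1.le, hμ01.2⟩
    rw [show μ * x₁ + (1 - μ) * x₂ = x₀ by linarith, hk2] at hc
    have e : μ * φ x₁ ≤ μ * (φ x₀ + k * (x₁ - x₀)) := by
      have : (1 - μ) * (k * (x₂ - x₀)) = - (μ * (k * (x₁ - x₀))) := by
        linear_combination k * (-1) * hμx
      linarith
    exact le_of_mul_le_mul_left e hμ01.1
  have hbern : ∀ r : ℝ, 0 < r → φ (Real.log r) ≤ φ x₀ + k * (Real.log r - x₀) →
      Real.exp (φ (Real.log r)) ≤ Real.exp (φ x₀) * (1 + k * (r / r₀ - 1)) := by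
    intro r hr h
    refine (Real.exp_le_exp.2 h).trans ?_
    rw [Real.exp_add]
    gcongr
    rw [hx₀, ← Real.log_div hr.ne' hr₀pos.ne']
    have hq : 0 < r / r₀ := by positivity
    have := rpow_one_add_le_one_add_mul_self (s := r / r₀ - 1) (by linarith) hk01.1 hk01.2
    rwa [add_sub_cancel, Real.rpow_def_of_pos hq, mul_comm (Real.log _)] at this
  have b1 := mul_le_mul_of_nonneg_left (hbern r₁ hr₁ hk1) hl.1
  have b2 := mul_le_mul_of_nonneg_left (hbern r₂ hr₂ hk2.le) (sub_nonneg.2 hl.2)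
  have hsum : l * (r₁ / r₀) + (1 - l) * (r₂ / r₀) = 1 := by
    rw [← mul_div_assoc, ← mul_div_assoc, ← add_div, ← hr₀, div_self hr₀pos.ne']
  have : l * (Real.exp (φ x₀) * (1 + k * (r₁ / r₀ - 1)))
      + (1 - l) * (Real.exp (φ x₀) * (1 + k * (r₂ / r₀ - 1))) = Real.exp (φ x₀) := by
    linear_combination Real.exp (φ x₀) * k * hsum
  linarith

theorem concave_exp_comp_log_rpow {g : ℝ → ℝ} {d p t : ℝ} (hd : 0 < d) (hp : 0 < p) (ht : 0 < t)
    (hconc : ∀ x y, ∀ l ∈ Set.Icc (0 : ℝ) 1, l * g x + (1 - l) * g y ≤ g (l * x + (1 - l) * y))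
    (hmono : Monotone g) (hanti : Antitone fun x => g x - d * x) {l : ℝ}
    (hl : l ∈ Set.Icc (0 : ℝ) 1) :
    l * Real.exp (p / d * g 0) + (1 - l) * Real.exp (p / d * g (Real.log t))
      ≤ Real.exp (p / d * g (Real.log ((l + (1 - l) * t ^ p) ^ (1 / p)))) := by
  have hpd : 0 < p / d := by positivity
  have htp : 0 < t ^ p := Real.rpow_pos_of_pos ht p
  have hpos : 0 < l + (1 - l) * t ^ p := by
    rcases eq_or_lt_of_le hl.1 with h | h
    · rw [← h]; simpa using htp
    · have := sub_nonneg.2 hl.2; positivity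
  have key := concave_exp_comp_log (φ := fun x => p / d * g (x / p)) ?_ ?_ ?_ one_pos htp hl
  · rw [Real.log_one, zero_div, Real.log_rpow ht, mul_div_cancel_left₀ _ hp.ne', mul_one] at key
    rwa [Real.log_rpow hpos, one_div_mul_eq_div]
  · intro x y s hs
    have := mul_le_mul_of_nonneg_left (hconc (x / p) (y / p) s hs) hpd.le
    rw [show s * (x / p) + (1 - s) * (y / p) = (s * x + (1 - s) * y) / p by ring] at this
    linarith
  · intro x y hxy
    exact mul_le_mul_of_nonneg_left (hmono (by gcongr)) hpd.le
  · intro x y hxy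
    have h1 : g (y / p) - d * (y / p) ≤ g (x / p) - d * (x / p) := hanti (by gcongr)
    have h2 := mul_le_mul_of_nonneg_left h1 hpd.le
    have h3 : ∀ z, p / d * (g (z / p) - d * (z / p)) = p / d * g (z / p) - z := by
      intro z; field_simp
    rwa [h3, h3] at h2

theorem gaussInt_le_exp_mul {n : ℕ} {K : Set (Euc n)} (hKm : MeasurableSet K) {R : ℝ}
    (hR : ∀ x ∈ K, ‖x‖ ≤ R) (a b : ℝ) :
    gaussInt K a ≤ ENNReal.ofReal (Real.exp (|a - b| * (R ^ 2 / 2))) * gaussInt K b := by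
  rw [gaussInt, gaussInt, ← lintegral_const_mul _ (by fun_prop)]
  refine setLIntegral_mono' hKm fun x hx => ?_
  rw [← ENNReal.ofReal_mul (Real.exp_nonneg _), ← Real.exp_add]
  refine ENNReal.ofReal_le_ofReal (Real.exp_le_exp.2 ?_)
  have h1 : ‖x‖ ^ 2 ≤ R ^ 2 := by have := hR x hx; gcongr
  have h2 : -(a - b) ≤ |a - b| := neg_le_abs _
  nlinarith [mul_le_mul h2 h1 (sq_nonneg _) (abs_nonneg _)]

theorem gaussInt_anti {n : ℕ} (K : Set (Euc n)) {a b : ℝ} (hab : a ≤ b) :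
    gaussInt K b ≤ gaussInt K a := by
  refine lintegral_mono fun x => ENNReal.ofReal_le_ofReal (Real.exp_le_exp.2 ?_)
  have := mul_le_mul_of_nonneg_right hab (sq_nonneg ‖x‖)
  linarith

theorem gaussInt_zero {n : ℕ} (K : Set (Euc n)) : gaussInt K 0 = volume K := by
  simp [gaussInt]

theorem gaussInt_pos_and_ne_top {n : ℕ} {K : Set (Euc n)} (hK : IsConvexBody K) (a : ℝ) :
    0 < gaussInt K a ∧ gaussInt K a ≠ ∞ := by
  obtain ⟨R, hR⟩ := hK.1.isBounded.exists_norm_le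
  have hKm := hK.1.measurableSet
  constructor
  · have h := gaussInt_le_exp_mul hKm hR 0 a
    rw [gaussInt_zero] at h
    have hv : 0 < volume K := Measure.measure_pos_of_nonempty_interior _ hK.2.2
    refine pos_iff_ne_zero.2 fun h0 => ?_
    rw [h0, mul_zero] at h
    exact absurd h (not_le.2 hv)
  · refine ne_top_of_le_ne_top ?_ (gaussInt_le_exp_mul hKm hR a 0)
    rw [gaussInt_zero]
    exact ENNReal.mul_ne_top ENNReal.ofReal_ne_top hK.1.measure_lt_top.ne

theorem log_gaussInt_le {n : ℕ} {K : Set (Euc n)} (hK : IsConvexBody K) {R : ℝ}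
    (hR : ∀ x ∈ K, ‖x‖ ≤ R) (a b : ℝ) :
    Real.log (gaussInt K a).toReal
      ≤ Real.log (gaussInt K b).toReal + |a - b| * (R ^ 2 / 2) := by
  have hpos : ∀ a, 0 < (gaussInt K a).toReal := fun a =>
    ENNReal.toReal_pos (gaussInt_pos_and_ne_top hK a).1.ne' (gaussInt_pos_and_ne_top hK a).2
  have h := ENNReal.toReal_mono (ENNReal.mul_ne_top ENNReal.ofReal_ne_top
    (gaussInt_pos_and_ne_top hK b).2) (gaussInt_le_exp_mul hK.1.measurableSet hR a b)
  rw [ENNReal.toReal_mul, ENNReal.toReal_ofReal (Real.exp_nonneg _)] at h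
  have := Real.log_le_log (hpos a) h
  rwa [Real.log_mul (Real.exp_ne_zero _) (hpos b).ne', Real.log_exp, add_comm] at this

/-- Iterating the arithmetic and harmonic means gives the inequality at the geometric mean. -/
theorem log_gaussInt_add_le {n : ℕ} {K : Set (Euc n)} (hK : IsConvexBody K)
    (hsym : ∀ x ∈ K, -x ∈ K) {a b m : ℝ} (ha : 0 < a) (hb : 0 < b) (hm : 0 < m)
    (hmab : m * m = a * b) :
    Real.log (gaussInt K a).toReal + Real.log (gaussInt K b).toReal
      ≤ 2 * Real.log (gaussInt K m).toReal := by
  have hpos : ∀ a, 0 < (gaussInt K a).toReal := fun a =>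
    ENNReal.toReal_pos (gaussInt_pos_and_ne_top hK a).1.ne' (gaussInt_pos_and_ne_top hK a).2
  obtain ⟨R, hR⟩ := hK.1.isBounded.exists_norm_le
  have hiter : ∀ k : ℕ, ∃ a' b' : ℝ, 0 < a' ∧ 0 < b' ∧ a' * b' = a * b ∧
      |a' - b'| ≤ |a - b| * (1 / 2) ^ k ∧
      Real.log (gaussInt K a).toReal + Real.log (gaussInt K b).toReal
        ≤ Real.log (gaussInt K a').toReal + Real.log (gaussInt K b').toReal := by
    intro k
    induction k with
    | zero => exact ⟨a, b, ha, hb, rfl, by simp, le_rfl⟩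
    | succ k ih =>
      obtain ⟨a₁, b₁, ha₁, hb₁, hab₁, hd₁, hle₁⟩ := ih
      obtain ⟨a₂, b₂, ha₂, hb₂, hab₂, hd₂, hle₂⟩ :=
        gaussInt_mul_gaussInt_le_means hK.1.measurableSet hK.2.1 hsym ha₁ hb₁
      refine ⟨a₂, b₂, ha₂, hb₂, hab₂.trans hab₁, ?_, hle₁.trans ?_⟩
      · rw [pow_succ]; linarith
      · have h := ENNReal.toReal_mono (ENNReal.mul_ne_top (gaussInt_pos_and_ne_top hK a₂).2
          (gaussInt_pos_and_ne_top hK b₂).2) hle₂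
        rw [ENNReal.toReal_mul, ENNReal.toReal_mul] at h
        rw [← Real.log_mul (hpos _).ne' (hpos _).ne', ← Real.log_mul (hpos _).ne' (hpos _).ne']
        exact Real.log_le_log (mul_pos (hpos _) (hpos _)) h
  have hlim : Filter.Tendsto (fun k : ℕ => 2 * Real.log (gaussInt K m).toReal
      + |a - b| * (1 / 2) ^ k * R ^ 2) Filter.atTop
      (nhds (2 * Real.log (gaussInt K m).toReal + |a - b| * 0 * R ^ 2)) :=
    (((tendsto_pow_atTop_nhds_zero_of_lt_one (by norm_num) (by norm_num)).const_mul
      _).mul_const _).const_add _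
  rw [mul_zero, zero_mul, add_zero] at hlim
  refine ge_of_tendsto' hlim fun k => ?_
  obtain ⟨a', b', ha', hb', hab', hd, hle⟩ := hiter k
  have hclose : ∀ x y : ℝ, 0 < x → 0 < y → x * y = m * m → |x - m| ≤ |x - y| := by
    intro x y hx hy hxy
    rcases le_total x m with h | h
    · have hym : m ≤ y := by
        by_contra! hlt; nlinarith
      rw [abs_of_nonpos (by linarith), abs_of_nonpos (by linarith)]; linarith
    · have hym : y ≤ m := by
        by_contra! hlt; nlinarith
      rw [abs_of_nonneg (by linarith), abs_of_nonneg (by linarith)]; linarith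
  have c1 := hclose a' b' ha' hb' (by linarith)
  have c2 := hclose b' a' hb' ha' (by linarith)
  rw [abs_sub_comm b' a'] at c2
  have l1 := log_gaussInt_le hK hR a' m
  have l2 := log_gaussInt_le hK hR b' m
  have m1 := mul_le_mul_of_nonneg_right (c1.trans hd) (by positivity : 0 ≤ R ^ 2 / 2)
  have m2 := mul_le_mul_of_nonneg_right (c2.trans hd) (by positivity : 0 ≤ R ^ 2 / 2)
  linarith

theorem gaussianMeasure_smul {n : ℕ} {K : Set (Euc n)} (hKm : MeasurableSet K) {s : ℝ}
    (hs : 0 < s) : gaussianMeasure n (s • K)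
      = ENNReal.ofReal ((2 * Real.pi) ^ (-(n : ℝ) / 2)) * ENNReal.ofReal (s ^ n)
        * gaussInt K (s ^ 2) := by
  have hsK : MeasurableSet (s • K) := hKm.const_smul₀ s
  have hpre : (fun x : Euc n => s • x) ⁻¹' (s • K) = K := by
    ext x; simp [Set.smul_mem_smul_set_iff₀ hs.ne']
  have hmap := Measure.map_addHaar_smul (volume : Measure (Euc n)) hs.ne'
  have key := setLIntegral_map (μ := (volume : Measure (Euc n))) hsK
    (f := fun x : Euc n => ENNReal.ofReal (Real.exp (-‖x‖ ^ 2 / 2)))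
    (g := fun x : Euc n => s • x) (by fun_prop) (by fun_prop)
  rw [hpre, hmap, Measure.restrict_smul, lintegral_smul_measure, finrank_euclideanSpace_fin,
    smul_eq_mul, abs_of_pos (by positivity)] at key
  have hg : gaussInt K (s ^ 2) = ∫⁻ x in K, ENNReal.ofReal (Real.exp (-‖s • x‖ ^ 2 / 2)) := by
    rw [gaussInt]
    congr 1 with x
    rw [norm_smul, mul_pow, Real.norm_eq_abs, sq_abs, neg_mul]
  have hc : (0 : ℝ) ≤ (2 * Real.pi) ^ (-(n : ℝ) / 2) := by positivity
  rw [gaussianMeasure, withDensity_apply _ hsK, hg, ← key, mul_assoc, ← mul_assoc (ENNReal.ofReal _)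
    (ENNReal.ofReal _) (∫⁻ _ in _, _), ← ENNReal.ofReal_mul (by positivity),
    mul_inv_cancel₀ (by positivity), ENNReal.ofReal_one, one_mul,
    ← lintegral_const_mul _ (by fun_prop)]
  simp only [ENNReal.ofReal_mul hc]

/-- The function `τ ↦ log γ(e^τ K)`, up to an additive constant. -/
def logGauss {n : ℕ} (K : Set (Euc n)) (τ : ℝ) : ℝ :=
  n * τ + Real.log (gaussInt K (Real.exp (2 * τ))).toReal

theorem gaussianMeasure_smul_eq_exp_logGauss {n : ℕ} {K : Set (Euc n)} (hK : IsConvexBody K)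
    {s : ℝ} (hs : 0 < s) : gaussianMeasure n (s • K)
      = ENNReal.ofReal ((2 * Real.pi) ^ (-(n : ℝ) / 2) * Real.exp (logGauss K (Real.log s))) := by
  have hfin := gaussInt_pos_and_ne_top hK (s ^ 2)
  have h2 : Real.exp (2 * Real.log s) = s ^ 2 := by
    rw [mul_comm, Real.exp_mul, Real.exp_log hs]; norm_num
  rw [gaussianMeasure_smul hK.1.measurableSet hs, logGauss, h2, Real.exp_add,
    Real.exp_log (ENNReal.toReal_pos hfin.1.ne' hfin.2), Real.exp_nat_mul, Real.exp_log hs,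
    ENNReal.ofReal_mul (by positivity), ENNReal.ofReal_mul (by positivity),
    ENNReal.ofReal_toReal hfin.2, mul_assoc]

theorem continuous_logGauss {n : ℕ} {K : Set (Euc n)} (hK : IsConvexBody K) :
    Continuous (logGauss K) := by
  obtain ⟨R, hR⟩ := hK.1.isBounded.exists_norm_le
  have hlip : LipschitzWith (R ^ 2 / 2).toNNReal fun a => Real.log (gaussInt K a).toReal := by
    refine LipschitzWith.of_le_add_mul _ fun a b => ?_
    rw [Real.coe_toNNReal _ (by positivity), Real.dist_eq, mul_comm]
    exact log_gaussInt_le hK hR a b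
  exact (by fun_prop : Continuous fun τ : ℝ => (n : ℝ) * τ).add
    (hlip.continuous.comp (by fun_prop : Continuous fun τ : ℝ => Real.exp (2 * τ)))

theorem logGauss_antitone_sub {n : ℕ} {K : Set (Euc n)} (hK : IsConvexBody K) :
    Antitone fun τ => logGauss K τ - n * τ := by
  intro σ τ hστ
  have hfin := fun a => gaussInt_pos_and_ne_top hK a
  simp only [logGauss, add_sub_cancel_left]
  refine Real.log_le_log (ENNReal.toReal_pos (hfin _).1.ne' (hfin _).2)
    (ENNReal.toReal_mono (hfin _).2 (gaussInt_anti K ?_))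
  exact Real.exp_le_exp.2 (by linarith)

theorem logGauss_mono {n : ℕ} {K : Set (Euc n)} (hK : IsConvexBody K) (h0 : (0 : Euc n) ∈ K) :
    Monotone (logGauss K) := by
  intro σ τ hστ
  have hsub : Real.exp σ • K ⊆ Real.exp τ • K := by
    rintro _ ⟨x, hx, rfl⟩
    refine ⟨(Real.exp σ / Real.exp τ) • x, ?_, ?_⟩
    · exact hK.2.1.smul_mem_of_zero_mem h0 hx
        ⟨by positivity, (div_le_one (Real.exp_pos _)).2 (Real.exp_le_exp.2 hστ)⟩
    · simp only [smul_smul]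
      rw [mul_div_cancel₀ _ (Real.exp_ne_zero _)]
  have h := measure_mono (μ := gaussianMeasure n) hsub
  rw [gaussianMeasure_smul_eq_exp_logGauss hK (Real.exp_pos _),
    gaussianMeasure_smul_eq_exp_logGauss hK (Real.exp_pos _), Real.log_exp, Real.log_exp,
    ENNReal.ofReal_le_ofReal_iff (by positivity)] at h
  exact Real.exp_le_exp.1 (le_of_mul_le_mul_left h (by positivity))

/-- The (B)-theorem for the Gaussian measure: `τ ↦ γ(e^τ K)` is log-concave. -/
theorem logGauss_concave {n : ℕ} {K : Set (Euc n)} (hK : IsConvexBody K)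
    (hsym : ∀ x ∈ K, -x ∈ K) (x y : ℝ) {l : ℝ} (hl : l ∈ Set.Icc (0 : ℝ) 1) :
    l * logGauss K x + (1 - l) * logGauss K y ≤ logGauss K (l * x + (1 - l) * y) := by
  refine (continuous_logGauss hK).concave_of_midpoint (fun σ τ => ?_) x y hl
  have h := log_gaussInt_add_le hK hsym (Real.exp_pos (2 * σ)) (Real.exp_pos (2 * τ))
    (Real.exp_pos (2 * ((σ + τ) / 2))) (by rw [← Real.exp_add, ← Real.exp_add]; congr 1; ring)
  simp only [logGauss]
  linarith

theorem inner_le_suppFn {n : ℕ} {K : Set (Euc n)} (hK : IsCompact K) (u : Euc n) {y : Euc n}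
    (hy : y ∈ K) : ⟪u, y⟫ ≤ suppFn K u :=
  le_csSup (hK.image (by fun_prop)).bddAbove ⟨y, hy, rfl⟩

theorem suppFn_smul {n : ℕ} (K : Set (Euc n)) {t : ℝ} (ht : 0 ≤ t) (u : Euc n) :
    suppFn (t • K) u = t * suppFn K u := by
  have : (fun y => ⟪u, y⟫) '' (t • K) = t • ((fun y => ⟪u, y⟫) '' K) := by
    rw [← Set.image_smul, ← Set.image_smul, Set.image_image, Set.image_image]
    simp only [inner_smul_right, smul_eq_mul]
  rw [suppFn, this, Real.sSup_smul_of_nonneg ht, suppFn, smul_eq_mul]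

theorem smul_subset_lpComb {n : ℕ} {K : Set (Euc n)} (hK : IsCompact K) (h0 : (0 : Euc n) ∈ K)
    {t p l : ℝ} (ht : 0 < t) (hp : 0 < p) (hl : l ∈ Set.Icc (0 : ℝ) 1) :
    (l + (1 - l) * t ^ p) ^ (1 / p) • K ⊆ lpComb p l K (t • K) := by
  rintro _ ⟨y, hy, rfl⟩
  rw [lpComb, if_neg hp.ne']
  intro u _
  have hnn : 0 ≤ suppFn K u := by simpa using inner_le_suppFn hK u h0
  have hl1 := sub_nonneg.2 hl.2
  have hb : 0 ≤ l + (1 - l) * t ^ p := by have := hl.1; positivity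
  rw [suppFn_smul K ht.le, Real.mul_rpow ht.le hnn,
    show l * suppFn K u ^ p + (1 - l) * (t ^ p * suppFn K u ^ p)
      = (l + (1 - l) * t ^ p) * suppFn K u ^ p by ring,
    Real.mul_rpow hb (Real.rpow_nonneg hnn _), ← Real.rpow_mul hnn, mul_one_div_cancel hp.ne',
    Real.rpow_one, real_inner_comm]
  simp only [inner_smul_right]
  have := inner_le_suppFn hK u hy
  gcongr

/-- Theorem 1.8: the `(p,p)`-inequality holds for the Gaussian measure when the two
bodies are dilates: for `p ∈ (0,1]`, `t > 0` and `λ ∈ [0,1]`,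
`γ(λK +_p (1-λ)(tK))^{p/n} ≥ λ γ(K)^{p/n} + (1-λ) γ(tK)^{p/n}`. -/
theorem gaussian_pp_dilates (n : ℕ) (hn : 1 ≤ n)
    (K : Set (Euc n)) (hK : IsConvexBody K) (hKsym : K = -K)
    (t : ℝ) (ht : 0 < t)
    (p : ℝ) (hp0 : 0 < p) (hp1 : p ≤ 1) :
    ∀ lam ∈ Set.Icc (0:ℝ) 1,
      ENNReal.ofReal lam * gaussianMeasure n K ^ (p / (n : ℝ))
          + ENNReal.ofReal (1 - lam) * gaussianMeasure n (t • K) ^ (p / (n : ℝ))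
        ≤ gaussianMeasure n (lpComb p lam K (t • K)) ^ (p / (n : ℝ)) := by
  intro lam hlam
  have hsym : ∀ x ∈ K, -x ∈ K := fun x hx => by rw [hKsym]; simpa using hx
  have h0 : (0 : Euc n) ∈ K := by
    obtain ⟨x, hx⟩ := hK.2.2
    have hxK := interior_subset hx
    have := hK.2.1 hxK (hsym x hxK) (by norm_num : (0 : ℝ) ≤ 1 / 2) (by norm_num : (0 : ℝ) ≤ 1 / 2)
      (by norm_num)
    simpa using this
  have hn0 : (0 : ℝ) < n := by exact_mod_cast hn
  have hpn : 0 ≤ p / (n : ℝ) := by positivity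
  have hlam1 := sub_nonneg.2 hlam.2
  have hs : 0 < (lam + (1 - lam) * t ^ p) ^ (1 / p) := by
    have htp : 0 < t ^ p := Real.rpow_pos_of_pos ht p
    refine Real.rpow_pos_of_pos ?_ _
    rcases eq_or_lt_of_le hlam.1 with h | h
    · rw [← h]; simpa using htp
    · positivity
  refine le_trans ?_ (ENNReal.rpow_le_rpow
    (measure_mono (smul_subset_lpComb hK.1 h0 ht hp0 hlam)) hpn)
  have hpow : ∀ s : ℝ, 0 < s → gaussianMeasure n (s • K) ^ (p / (n : ℝ))
      = ENNReal.ofReal (((2 * Real.pi) ^ (-(n : ℝ) / 2)) ^ (p / (n : ℝ))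
        * Real.exp (p / n * logGauss K (Real.log s))) := by
    intro s hs
    rw [gaussianMeasure_smul_eq_exp_logGauss hK hs, ENNReal.ofReal_rpow_of_pos (by positivity),
      Real.mul_rpow (by positivity) (Real.exp_nonneg _), ← Real.exp_mul,
      mul_comm (logGauss K (Real.log s))]
  have hone := hpow 1 one_pos
  rw [one_smul, Real.log_one] at hone
  rw [hone, hpow t ht, hpow _ hs, ← ENNReal.ofReal_mul hlam.1, ← ENNReal.ofReal_mul hlam1,
    ← ENNReal.ofReal_add (by have := hlam.1; positivity) (by positivity)]
  refine ENNReal.ofReal_le_ofReal ?_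
  have key := mul_le_mul_of_nonneg_left (concave_exp_comp_log_rpow hn0 hp0 ht
    (fun x y l hl => logGauss_concave hK hsym x y hl) (logGauss_mono hK h0)
    (logGauss_antitone_sub hK) hlam)
    (by positivity : (0 : ℝ) ≤ ((2 * Real.pi) ^ (-(n : ℝ) / 2)) ^ (p / (n : ℝ)))
  linarith

end
end

section
/- Let p ∈ (0,1], and let K and L be polytopes in ℝⁿ containing the origin in their interiors. For λ ∈ [0,1] write K_λ = (1−λ)·K +_p λ·L. Let α, β, γ ∈ [0,1] and λ = (1−γ)α + γβ. If K_α, K_λ and K_β are pairwise strongly isomorphic, then K_λ = (1−γ)·K_α +_p γ·K_β. -/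
open MeasureTheory
open scoped RealInnerProductSpace ENNReal

noncomputable section

/-- A polytope: the convex hull of a finite set of points. -/
def IsPolytope {n : ℕ} (K : Set (Euc n)) : Prop :=
  ∃ S : Finset (Euc n), K = convexHull ℝ (S : Set (Euc n))

/-- The support set `F(K, u) = {x ∈ K : ⟨x, u⟩ = h_K(u)}`. -/
def suppSet {n : ℕ} (K : Set (Euc n)) (u : Euc n) : Set (Euc n) :=
  {x ∈ K | ⟪u, x⟫ = suppFn K u}

/-- Dimension (of the affine hull) of a set. -/
def affDim {n : ℕ} (s : Set (Euc n)) : ℕ :=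
  Module.finrank ℝ (affineSpan ℝ s).direction

/-- Two polytopes are strongly isomorphic if their support sets in every direction
have the same dimension. -/
def StronglyIsomorphic {n : ℕ} (P Q : Set (Euc n)) : Prop :=
  ∀ u : Euc n, ‖u‖ = 1 → affDim (suppSet P u) = affDim (suppSet Q u)

section SupportFunction

variable {n : ℕ} {Q : Set (Euc n)} {S : Finset (Euc n)} {u v x y : Euc n}

theorem bddAbove_inner_image (hQ : IsCompact Q) (u : Euc n) :
    BddAbove ((fun y => ⟪u, y⟫) '' Q) :=
  (hQ.image (by fun_prop)).bddAbove

theorem inner_le_suppFn_s14 (hQ : IsCompact Q) (hy : y ∈ Q) : ⟪u, y⟫ ≤ suppFn Q u :=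
  le_csSup (bddAbove_inner_image hQ u) ⟨y, hy, rfl⟩

theorem suppFn_le (hQ : Q.Nonempty) {c : ℝ} (h : ∀ y ∈ Q, ⟪u, y⟫ ≤ c) : suppFn Q u ≤ c :=
  csSup_le (hQ.image _) (by rintro _ ⟨y, hy, rfl⟩; exact h y hy)

theorem mem_suppSet_iff (hQ : IsCompact Q) :
    x ∈ suppSet Q u ↔ x ∈ Q ∧ ∀ y ∈ Q, ⟪u, y⟫ ≤ ⟪u, x⟫ := by
  refine and_congr_right fun hx => ⟨fun h y hy => h ▸ inner_le_suppFn_s14 hQ hy, fun h => ?_⟩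
  exact le_antisymm (inner_le_suppFn_s14 hQ hx) (suppFn_le ⟨x, hx⟩ h)

theorem suppSet_nonempty (hQ : IsCompact Q) (hne : Q.Nonempty) (u : Euc n) :
    (suppSet Q u).Nonempty := by
  obtain ⟨x, hx, hmax⟩ := hQ.exists_isMaxOn hne (f := fun y => ⟪u, y⟫) (by fun_prop)
  exact ⟨x, (mem_suppSet_iff hQ).2 ⟨hx, hmax⟩⟩

theorem suppSet_smul (hQ : IsCompact Q) {c : ℝ} (hc : 0 < c) (u : Euc n) :
    suppSet Q (c • u) = suppSet Q u := by
  ext x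
  simp [mem_suppSet_iff hQ, inner_smul_left, hc]

theorem suppFn_smul_s14 (hQ : IsCompact Q) (hne : Q.Nonempty) {c : ℝ} (hc : 0 < c) (u : Euc n) :
    suppFn Q (c • u) = c * suppFn Q u := by
  obtain ⟨x, hx⟩ := suppSet_nonempty hQ hne u
  rw [← hx.2, ← ((suppSet_smul hQ hc u).symm ▸ hx : x ∈ suppSet Q (c • u)).2, inner_smul_left]
  simp

theorem suppFn_add_of_mem (hu : x ∈ suppSet Q u) (hv : x ∈ suppSet Q v)
    (huv : x ∈ suppSet Q (u + v)) : suppFn Q (u + v) = suppFn Q u + suppFn Q v := by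
  rw [← hu.2, ← hv.2, ← huv.2, inner_add_left]

theorem suppFn_pos (hQ : IsCompact Q) (h0 : (0 : Euc n) ∈ interior Q) (hu : u ≠ 0) :
    0 < suppFn Q u := by
  obtain ⟨ε, hε, hball⟩ := Metric.mem_nhds_iff.1 (mem_interior_iff_mem_nhds.1 h0)
  have hn : 0 < ‖u‖ := norm_pos_iff.2 hu
  have hmem : (ε / 2 / ‖u‖) • u ∈ Q := hball <| by
    rw [mem_ball_zero_iff, norm_smul, Real.norm_of_nonneg (by positivity),
      div_mul_cancel₀ _ hn.ne']
    linarith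
  refine lt_of_lt_of_le ?_ (inner_le_suppFn_s14 hQ hmem)
  rw [inner_smul_right, real_inner_self_eq_norm_sq]
  positivity

theorem nonempty_of_zero_mem_interior (h0 : (0 : Euc n) ∈ interior Q) : Q.Nonempty :=
  ⟨0, interior_subset h0⟩

theorem IsPolytope.isCompact (hQ : IsPolytope Q) : IsCompact Q := by
  obtain ⟨S, rfl⟩ := hQ
  exact S.finite_toSet.isCompact_convexHull ℝ

theorem convex_suppSet (hQ : Convex ℝ Q) (u : Euc n) : Convex ℝ (suppSet Q u) :=
  hQ.inter (convex_hyperplane (f := fun y => ⟪u, y⟫) ⟨fun x y => inner_add_right u x y,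
    fun c x => inner_smul_right u x c⟩ _)

/-- A support set of a polytope is spanned by the vertices it contains. -/
theorem suppSet_convexHull_subset :
    suppSet (convexHull ℝ (S : Set (Euc n))) u ⊆
      convexHull ℝ {s | s ∈ S ∧ s ∈ suppSet (convexHull ℝ (S : Set (Euc n))) u} := by
  intro x hx
  have hc : IsCompact (convexHull ℝ (S : Set (Euc n))) := S.finite_toSet.isCompact_convexHull ℝ
  obtain ⟨w, hw0, hw1, hwx⟩ := Finset.mem_convexHull'.1 hx.1
  have hS : ∀ s ∈ S, s ∈ convexHull ℝ (S : Set (Euc n)) := fun s hs => subset_convexHull ℝ _ hs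
  have hle : ∀ s ∈ S, w s * ⟪u, s⟫ ≤ w s * suppFn (convexHull ℝ (S : Set (Euc n))) u :=
    fun s hs => mul_le_mul_of_nonneg_left (inner_le_suppFn_s14 hc (hS s hs)) (hw0 s hs)
  have heq : ∑ s ∈ S, w s * ⟪u, s⟫ =
      ∑ s ∈ S, w s * suppFn (convexHull ℝ (S : Set (Euc n))) u := by
    rw [← Finset.sum_mul, hw1, one_mul, ← hx.2, ← hwx, inner_sum]
    simp [inner_smul_right]
  have hall := (Finset.sum_eq_sum_iff_of_le hle).1 heq
  have hmem : ∀ s ∈ S, w s ≠ 0 → s ∈ suppSet (convexHull ℝ (S : Set (Euc n))) u :=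
    fun s hs hne => ⟨hS s hs, mul_left_cancel₀ hne (hall s hs)⟩
  rw [← hwx, ← Finset.sum_filter_of_ne (p := fun s => w s ≠ 0)
    (fun s _ h hw => h (by rw [hw, zero_smul]))]
  refine (convex_convexHull ℝ _).sum_mem (fun s hs => hw0 s (Finset.mem_filter.1 hs).1) ?_
    (fun s hs => subset_convexHull ℝ _ ?_)
  · rw [Finset.sum_filter_ne_zero, hw1]
  · obtain ⟨hs, hne⟩ := Finset.mem_filter.1 hs
    exact ⟨hs, hmem s hs hne⟩

theorem span_suppSet_le :
    Submodule.span ℝ (suppSet (convexHull ℝ (S : Set (Euc n))) u) ≤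
      Submodule.span ℝ {s | s ∈ S ∧ s ∈ suppSet (convexHull ℝ (S : Set (Euc n))) u} :=
  Submodule.span_le.2 <| suppSet_convexHull_subset.trans <|
    convexHull_min Submodule.subset_span (Submodule.convex _)

/-- Support sets of a polytope are upper semicontinuous in the direction. -/
theorem IsPolytope.eventually_suppSet_subset (hQ : IsPolytope Q) (hne : Q.Nonempty) (u : Euc n) :
    ∀ᶠ v in nhds u, suppSet Q v ⊆ suppSet Q u := by
  have hc := hQ.isCompact
  obtain ⟨S, rfl⟩ := hQ
  obtain ⟨a, ha⟩ := suppSet_nonempty hc hne u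
  have hev : ∀ᶠ v in nhds u, ∀ s ∈ S, s ∉ suppSet (convexHull ℝ (S : Set (Euc n))) u →
      ⟪v, s⟫ < ⟪v, a⟫ := by
    refine (Filter.eventually_all_finset S).2 fun s hs => ?_
    by_cases hsu : s ∈ suppSet (convexHull ℝ (S : Set (Euc n))) u
    · exact Filter.Eventually.of_forall fun v h => (h hsu).elim
    have hsQ : s ∈ convexHull ℝ (S : Set (Euc n)) := subset_convexHull ℝ _ hs
    have hlt : ⟪u, s⟫ < ⟪u, a⟫ := by
      rw [ha.2]
      exact lt_of_le_of_ne (inner_le_suppFn_s14 hc hsQ) fun h => hsu ⟨hsQ, h⟩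
    filter_upwards [(by fun_prop : Continuous fun v : Euc n => ⟪v, s⟫).continuousAt.eventually_lt
      (by fun_prop : Continuous fun v : Euc n => ⟪v, a⟫).continuousAt hlt] with v hv _ using hv
  filter_upwards [hev] with v hv
  refine suppSet_convexHull_subset.trans
    (convexHull_min ?_ (convex_suppSet (convex_convexHull ℝ _) u))
  rintro s ⟨hs, hsv⟩
  by_contra hsu
  exact (((mem_suppSet_iff hc).1 hsv).2 a ha.1).not_gt (hv s hs hsu)

end SupportFunction

section Faces

variable {n : ℕ} {Q : Set (Euc n)} {u v : Euc n}

theorem finrank_span_suppSet (hne : (suppSet Q u).Nonempty) (hpos : 0 < suppFn Q u) :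
    Module.finrank ℝ (Submodule.span ℝ (suppSet Q u)) = affDim (suppSet Q u) + 1 := by
  obtain ⟨a, ha⟩ := hne
  have ha0 : a ≠ 0 := by
    rintro rfl
    exact hpos.ne (by simpa using ha.2)
  rw [affDim, direction_affineSpan]
  have hdir : ∀ x ∈ vectorSpan ℝ (suppSet Q u), ⟪u, x⟫ = 0 := by
    intro x hx
    rw [vectorSpan_eq_span_vsub_set_right ℝ ha] at hx
    induction hx using Submodule.span_induction with
    | mem x hx =>
      obtain ⟨y, hy, rfl⟩ := hx
      simp [inner_sub_right, hy.2, ha.2]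
    | zero => simp
    | add x y _ _ hx hy => rw [inner_add_right, hx, hy, add_zero]
    | smul c x _ hx => rw [inner_smul_right, hx, mul_zero]
  have hsup : vectorSpan ℝ (suppSet Q u) ⊔ Submodule.span ℝ {a} =
      Submodule.span ℝ (suppSet Q u) := by
    apply le_antisymm
    · refine sup_le ?_ (Submodule.span_mono (by simpa using ha))
      rw [vectorSpan_eq_span_vsub_set_right ℝ ha, Submodule.span_le]
      rintro _ ⟨y, hy, rfl⟩
      exact sub_mem (Submodule.subset_span hy) (Submodule.subset_span ha)
    · refine Submodule.span_le.2 fun y hy => ?_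
      rw [← sub_add_cancel y a]
      exact add_mem (Submodule.mem_sup_left (vsub_mem_vectorSpan ℝ hy ha))
        (Submodule.mem_sup_right (Submodule.mem_span_singleton_self a))
  have hinf : vectorSpan ℝ (suppSet Q u) ⊓ Submodule.span ℝ {a} = ⊥ := by
    refine (Submodule.eq_bot_iff _).2 fun x hx => ?_
    obtain ⟨c, rfl⟩ := Submodule.mem_span_singleton.1 hx.2
    have h := hdir _ hx.1
    rw [inner_smul_right, ha.2] at h
    rw [(mul_eq_zero.1 h).resolve_right hpos.ne', zero_smul]
  have h := Submodule.finrank_sup_add_finrank_inf_eq (vectorSpan ℝ (suppSet Q u))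
    (Submodule.span ℝ {a})
  rwa [hsup, hinf, finrank_bot, add_zero, finrank_span_singleton ha0] at h

theorem inner_mul_eq_of_mem_span {s : Set (Euc n)} {a b : ℝ} (hu : ∀ x ∈ s, ⟪u, x⟫ = a)
    (hv : ∀ x ∈ s, ⟪v, x⟫ = b) {x : Euc n} (hx : x ∈ Submodule.span ℝ s) :
    b * ⟪u, x⟫ = a * ⟪v, x⟫ := by
  induction hx using Submodule.span_induction with
  | mem x hx => rw [hu x hx, hv x hx, mul_comm]
  | zero => simp
  | add x y _ _ hx hy => simp only [inner_add_right, mul_add, hx, hy]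
  | smul c x _ hx => simp only [inner_smul_right]; linear_combination c * hx

theorem suppSet_eq_of_subset_of_affDim_eq (hne : (suppSet Q v).Nonempty)
    (hv : 0 < suppFn Q v) (hu : 0 < suppFn Q u) (hsub : suppSet Q v ⊆ suppSet Q u)
    (hdim : affDim (suppSet Q v) = affDim (suppSet Q u)) : suppSet Q v = suppSet Q u := by
  refine hsub.antisymm fun x hx => ⟨hx.1, ?_⟩
  have hspan : Submodule.span ℝ (suppSet Q v) = Submodule.span ℝ (suppSet Q u) :=
    Submodule.eq_of_le_of_finrank_eq (Submodule.span_mono hsub) <| by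
      rw [finrank_span_suppSet hne hv, finrank_span_suppSet (hne.mono hsub) hu, hdim]
  have h := inner_mul_eq_of_mem_span (fun y hy => (hsub hy).2) (fun y hy => hy.2)
    (hspan ▸ Submodule.subset_span hx : x ∈ Submodule.span ℝ (suppSet Q v))
  rw [hx.2, mul_comm] at h
  exact (mul_left_cancel₀ hu.ne' h).symm

/-- Turning `u` in a direction orthogonal to its support set, one reaches a larger support set. -/
theorem exists_suppSet_subset_add_smul (hQ : IsPolytope Q) (h0 : (0 : Euc n) ∈ interior Q)
    {d : Euc n} (hd : d ≠ 0) (hperp : ∀ x ∈ suppSet Q u, ⟪d, x⟫ = 0) :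
    ∃ t : ℝ, 0 < t ∧ suppSet Q u ⊆ suppSet Q (u + t • d) ∧
      ∃ s ∈ suppSet Q (u + t • d), ⟪d, s⟫ ≠ 0 := by
  have hc := hQ.isCompact
  have hdpos := suppFn_pos hc h0 hd
  obtain ⟨a, ha⟩ := suppSet_nonempty hc ⟨0, interior_subset h0⟩ u
  obtain ⟨e, he⟩ := suppSet_nonempty hc ⟨0, interior_subset h0⟩ d
  obtain ⟨S, rfl⟩ := hQ
  set Q := convexHull ℝ (S : Set (Euc n)) with hQdef
  have hSQ : ∀ s ∈ S, s ∈ Q := fun s hs => subset_convexHull ℝ _ hs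
  obtain ⟨e', he'S, he'⟩ : ∃ s ∈ S, s ∈ suppSet Q d := by
    obtain ⟨s, hs⟩ := convexHull_nonempty_iff.1 ⟨e, suppSet_convexHull_subset he⟩
    exact ⟨s, hs⟩
  have hne : (S.filter fun s => 0 < ⟪d, s⟫).Nonempty :=
    ⟨e', Finset.mem_filter.2 ⟨he'S, he'.2 ▸ hdpos⟩⟩
  obtain ⟨s, hs, hmin⟩ := Finset.exists_min_image _
    (fun s => (suppFn Q u - ⟪u, s⟫) / ⟪d, s⟫) hne
  obtain ⟨hsS, hsd⟩ := Finset.mem_filter.1 hs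
  set t := (suppFn Q u - ⟪u, s⟫) / ⟪d, s⟫ with ht
  have htpos : 0 < t := by
    refine div_pos (sub_pos.2 (lt_of_le_of_ne (inner_le_suppFn_s14 hc (hSQ s hsS)) fun h => ?_)) hsd
    exact hsd.ne' (hperp s ⟨hSQ s hsS, h⟩)
  have hts : ⟪u + t • d, s⟫ = suppFn Q u := by
    rw [inner_add_left, inner_smul_left, ht]
    simp [hsd.ne']
  have hle : ∀ y ∈ S, ⟪u + t • d, y⟫ ≤ suppFn Q u := by
    intro y hy
    have hyu := inner_le_suppFn_s14 (u := u) hc (hSQ y hy)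
    rw [inner_add_left, inner_smul_left]
    simp only [conj_trivial]
    rcases le_or_gt ⟪d, y⟫ 0 with hyd | hyd
    · nlinarith
    · have h := hmin y (Finset.mem_filter.2 ⟨hy, hyd⟩)
      rw [le_div_iff₀ hyd] at h
      linarith
  have hleQ : ∀ y ∈ Q, ⟪u + t • d, y⟫ ≤ suppFn Q u := fun y hy =>
    convexHull_min (t := {y | ⟪u + t • d, y⟫ ≤ suppFn Q u}) hle
      (convex_halfSpace_le ⟨fun x y => inner_add_right _ x y,
        fun c x => inner_smul_right _ x c⟩ _) hy
  refine ⟨t, htpos, fun x hx => (mem_suppSet_iff hc).2 ⟨hx.1, fun y hy => ?_⟩, s,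
    (mem_suppSet_iff hc).2 ⟨hSQ s hsS, fun y hy => hts ▸ hleQ y hy⟩, hsd.ne'⟩
  rw [inner_add_left (u) _ x, inner_smul_left, hperp x hx, hx.2, mul_zero, add_zero]
  exact hleQ y hy

/-- A property of directions that holds at facet normals and passes from `v`, `w` to `v + w` when
the support set of `v + w` is contained in those of `v` and `w` holds in every direction. -/
theorem facet_induction (hQ : IsPolytope Q) (h0 : (0 : Euc n) ∈ interior Q) {P : Euc n → Prop}
    (base : ∀ v ≠ 0, Submodule.span ℝ (suppSet Q v) = ⊤ → P v)
    (step : ∀ v w, v ≠ 0 → w ≠ 0 → v + w ≠ 0 → suppSet Q (v + w) ⊆ suppSet Q v →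
      suppSet Q (v + w) ⊆ suppSet Q w → P v → P w → P (v + w)) (hu : u ≠ 0) : P u := by
  have hc := hQ.isCompact
  induction hk : n - Module.finrank ℝ (Submodule.span ℝ (suppSet Q u)) using Nat.strong_induction_on
    generalizing u with
  | _ k ih =>
  by_cases htop : Submodule.span ℝ (suppSet Q u) = ⊤
  · exact base u hu htop
  obtain ⟨d, hd, hd0⟩ := Submodule.exists_mem_ne_zero_of_ne_bot
    (mt Submodule.orthogonal_eq_bot_iff.1 htop)
  have hperp : ∀ x ∈ suppSet Q u, ⟪d, x⟫ = 0 := fun x hx =>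
    Submodule.inner_left_of_mem_orthogonal (Submodule.subset_span hx) hd
  have hpos := suppFn_pos hc h0 hu
  obtain ⟨a, ha⟩ := suppSet_nonempty hc ⟨0, interior_subset h0⟩ u
  have key : ∀ e : Euc n, (∀ x ∈ Submodule.span ℝ (suppSet Q u), ⟪e, x⟫ = 0) → ∀ t : ℝ,
      suppSet Q u ⊆ suppSet Q (u + t • e) → (∃ s ∈ suppSet Q (u + t • e), ⟪e, s⟫ ≠ 0) →
      ∀ c : ℝ, 0 < c → c • (u + t • e) ≠ 0 ∧ P (c • (u + t • e)) := by
    intro e he t hsub hs c hcpos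
    obtain ⟨s, hs, hse⟩ := hs
    have hne : c • (u + t • e) ≠ 0 := by
      intro h
      have : ⟪c • (u + t • e), a⟫ = c * suppFn Q u := by
        rw [inner_smul_left, inner_add_left, inner_smul_left, he a (Submodule.subset_span ha), ha.2]
        simp
      rw [h, inner_zero_left] at this
      exact (mul_pos hcpos hpos).ne this
    refine ⟨hne, ih _ ?_ hne rfl⟩
    rw [suppSet_smul hc hcpos]
    have hlt : Submodule.span ℝ (suppSet Q u) < Submodule.span ℝ (suppSet Q (u + t • e)) :=
      SetLike.lt_iff_le_and_exists.2 ⟨Submodule.span_mono hsub, s, Submodule.subset_span hs,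
        fun h => hse (he s h)⟩
    have h1 := Submodule.finrank_lt_finrank_of_lt hlt
    have h2 := Submodule.finrank_le (Submodule.span ℝ (suppSet Q (u + t • e)))
    rw [finrank_euclideanSpace_fin] at h2
    omega
  have hspan : ∀ x ∈ Submodule.span ℝ (suppSet Q u), ⟪d, x⟫ = 0 := fun x hx =>
    Submodule.inner_left_of_mem_orthogonal hx hd
  obtain ⟨t₁, ht₁, hsub₁, hs₁⟩ := exists_suppSet_subset_add_smul hQ h0 hd0 hperp
  obtain ⟨t₂, ht₂, hsub₂, hs₂⟩ := exists_suppSet_subset_add_smul hQ h0 (neg_ne_zero.2 hd0)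
    (u := u) (fun x hx => by rw [inner_neg_left, hperp x hx, neg_zero])
  have hc₁ : 0 < t₂ / (t₁ + t₂) := by positivity
  have hc₂ : 0 < t₁ / (t₁ + t₂) := by positivity
  obtain ⟨hne₁, hP₁⟩ := key d hspan t₁ hsub₁ hs₁ _ hc₁
  obtain ⟨hne₂, hP₂⟩ := key (-d) (fun x hx => by rw [inner_neg_left, hspan x hx, neg_zero]) t₂
    hsub₂ hs₂ _ hc₂
  have hsum : (t₂ / (t₁ + t₂)) • (u + t₁ • d) + (t₁ / (t₁ + t₂)) • (u + t₂ • -d) = u := by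
    match_scalars <;> field_simp <;> ring
  have h := step _ _ hne₁ hne₂ (hsum.symm ▸ hu)
    (by rw [hsum, suppSet_smul hc hc₁]; exact hsub₁)
    (by rw [hsum, suppSet_smul hc hc₂]; exact hsub₂) hP₁ hP₂
  rwa [hsum] at h

end Faces

section StrongIsomorphism

variable {n : ℕ} {A B : Set (Euc n)} {v w x : Euc n}

theorem suppSet_add_smul_eq_inter (hA : IsCompact A) {t : ℝ} (ht : 0 < t)
    (hv : x ∈ suppSet A v) (hw : x ∈ suppSet A w) :
    suppSet A (v + t • w) = suppSet A v ∩ suppSet A w := by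
  have hle := fun y (hy : y ∈ A) => inner_le_suppFn_s14 (u := v) hA hy
  have hle' := fun y (hy : y ∈ A) => mul_le_mul_of_nonneg_left
    (inner_le_suppFn_s14 (u := w) hA hy) ht.le
  have hin : ∀ y : Euc n, ⟪v + t • w, y⟫ = ⟪v, y⟫ + t * ⟪w, y⟫ := fun y => by
    rw [inner_add_left, inner_smul_left]; simp
  ext y
  rw [Set.mem_inter_iff, mem_suppSet_iff hA]
  simp only [hin]
  constructor
  · rintro ⟨hy, hmax⟩
    have h := hmax x hv.1
    rw [hv.2, hw.2] at h
    have h1 := hle y hy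
    have h2 := hle' y hy
    refine ⟨⟨hy, by linarith⟩, hy, mul_left_cancel₀ ht.ne' (by linarith)⟩
  · rintro ⟨hyv, hyw⟩
    refine ⟨hyv.1, fun z hz => ?_⟩
    rw [hyv.2, hyw.2]
    exact add_le_add (hle z hz) (hle' z hz)

/-- Inclusions between support sets along a segment are preserved by strong isomorphism. -/
theorem StronglyIsomorphic.suppSet_add_subset_left (hA : IsCompact A)
    (hA0 : (0 : Euc n) ∈ interior A) (hB : IsPolytope B) (hB0 : (0 : Euc n) ∈ interior B)
    (hAB : ∀ u ≠ 0, affDim (suppSet A u) = affDim (suppSet B u))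
    (hv : v ≠ 0) (hw : w ≠ 0) (hAv : suppSet A (v + w) ⊆ suppSet A v)
    (hAw : suppSet A (v + w) ⊆ suppSet A w) : suppSet B (v + w) ⊆ suppSet B v := by
  have hBc := hB.isCompact
  have hBne := nonempty_of_zero_mem_interior hB0
  obtain ⟨a, ha⟩ := suppSet_nonempty hA ⟨0, interior_subset hA0⟩ (v + w)
  have hne : ∀ t ∈ Set.Ioi (0 : ℝ), v + t • w ≠ 0 := by
    intro t ht h
    have h1 : ⟪v + t • w, a⟫ = suppFn A v + t * suppFn A w := by
      rw [inner_add_left, inner_smul_left, (hAv ha).2, (hAw ha).2]; simp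
    rw [h, inner_zero_left] at h1
    have := mul_pos (Set.mem_Ioi.1 ht) (suppFn_pos hA hA0 hw)
    linarith [suppFn_pos hA hA0 hv]
  have hdim : ∀ t ∈ Set.Ioi (0 : ℝ), affDim (suppSet B (v + t • w)) =
      affDim (suppSet A v ∩ suppSet A w) := fun t ht => by
    rw [← hAB _ (hne t ht), suppSet_add_smul_eq_inter hA ht (hAv ha) (hAw ha)]
  have hconst : IsLocallyConstant fun t : Set.Ioi (0 : ℝ) => suppSet B (v + (t : ℝ) • w) := by
    refine (IsLocallyConstant.iff_eventually_eq _).2 fun t => ?_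
    have hcont : Continuous fun t : Set.Ioi (0 : ℝ) => v + (t : ℝ) • w := by fun_prop
    filter_upwards [hcont.continuousAt.eventually
      (hB.eventually_suppSet_subset hBne (v + (t : ℝ) • w))] with s hs
    exact suppSet_eq_of_subset_of_affDim_eq (suppSet_nonempty hBc hBne _)
      (suppFn_pos hBc hB0 (hne s s.2)) (suppFn_pos hBc hB0 (hne t t.2)) hs
      (by rw [hdim s s.2, hdim t t.2])
  have : PreconnectedSpace (Set.Ioi (0 : ℝ)) :=
    isPreconnected_iff_preconnectedSpace.1 isPreconnected_Ioi
  intro b hb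
  have hbt : ∀ t ∈ Set.Ioi (0 : ℝ), b ∈ suppSet B (v + t • w) := fun t ht => by
    have h := hconst.apply_eq_of_isPreconnected isPreconnected_univ
      (Set.mem_univ (⟨t, ht⟩ : Set.Ioi (0 : ℝ)))
      (Set.mem_univ (⟨1, Set.mem_Ioi.2 one_pos⟩ : Set.Ioi (0 : ℝ)))
    simp only [one_smul] at h
    exact h ▸ hb
  refine (mem_suppSet_iff hBc).2 ⟨hb.1, fun y hy => ?_⟩
  have hlim : ∀ z : Euc n, Filter.Tendsto (fun t : ℝ => ⟪v + t • w, z⟫)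
      (nhdsWithin 0 (Set.Ioi 0)) (nhds ⟪v, z⟫) := fun z => by
    have hcont : Continuous fun t : ℝ => ⟪v + t • w, z⟫ := by fun_prop
    simpa using (hcont.tendsto 0).mono_left nhdsWithin_le_nhds
  exact le_of_tendsto_of_tendsto (hlim y) (hlim b) <|
    eventually_nhdsWithin_of_forall fun t ht => ((mem_suppSet_iff hBc).1 (hbt t ht)).2 y hy

theorem StronglyIsomorphic.affDim_eq (h : StronglyIsomorphic A B) (hA : IsCompact A)
    (hB : IsCompact B) {u : Euc n} (hu : u ≠ 0) :
    affDim (suppSet A u) = affDim (suppSet B u) := by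
  have hn : 0 < ‖u‖ := norm_pos_iff.2 hu
  have := h (‖u‖⁻¹ • u) (by rw [norm_smul, norm_inv, norm_norm, inv_mul_cancel₀ hn.ne'])
  rwa [suppSet_smul hA (inv_pos.2 hn), suppSet_smul hB (inv_pos.2 hn)] at this

end StrongIsomorphism

section WeightedMean

/-- The weighted power mean `(s a^p + (1 - s) b^p)^{1/p}`. -/
def powMean (p s a b : ℝ) : ℝ := (s * a ^ p + (1 - s) * b ^ p) ^ (1 / p)

variable {p s a b a' b' c d : ℝ}

theorem powMean_self (hp : 0 < p) (ha : 0 ≤ a) : powMean p s a a = a := by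
  rw [powMean, ← add_mul, add_sub_cancel, one_mul, one_div, Real.rpow_rpow_inv ha hp.ne']

theorem powMean_inner_nonneg (hs : s ∈ Set.Icc (0 : ℝ) 1) (ha : 0 ≤ a) (hb : 0 ≤ b) :
    0 ≤ s * a ^ p + (1 - s) * b ^ p :=
  add_nonneg (mul_nonneg hs.1 (Real.rpow_nonneg ha p))
    (mul_nonneg (sub_nonneg.2 hs.2) (Real.rpow_nonneg hb p))

theorem powMean_mono (hp : 0 < p) (hs : s ∈ Set.Icc (0 : ℝ) 1) (ha : 0 ≤ a) (hb : 0 ≤ b)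
    (haa : a ≤ a') (hbb : b ≤ b') : powMean p s a b ≤ powMean p s a' b' := by
  have hs' := sub_nonneg.2 hs.2
  have hs0 := hs.1
  refine Real.rpow_le_rpow (powMean_inner_nonneg hs ha hb) ?_ (by positivity)
  gcongr

theorem powMean_smul (hp : 0 < p) (hs : s ∈ Set.Icc (0 : ℝ) 1) (hc : 0 ≤ c) (ha : 0 ≤ a)
    (hb : 0 ≤ b) : powMean p s (c * a) (c * b) = c * powMean p s a b := by
  rw [powMean, Real.mul_rpow hc ha, Real.mul_rpow hc hb,
    show s * (c ^ p * a ^ p) + (1 - s) * (c ^ p * b ^ p) =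
      c ^ p * (s * a ^ p + (1 - s) * b ^ p) by ring,
    Real.mul_rpow (Real.rpow_nonneg hc p) (powMean_inner_nonneg hs ha hb), one_div,
    Real.rpow_rpow_inv hc hp.ne', powMean, one_div]

theorem powMean_rpow (hp : 0 < p) (hs : s ∈ Set.Icc (0 : ℝ) 1) (ha : 0 ≤ a) (hb : 0 ≤ b) :
    powMean p s a b ^ p = s * a ^ p + (1 - s) * b ^ p := by
  rw [powMean, one_div, Real.rpow_inv_rpow (powMean_inner_nonneg hs ha hb) hp.ne']

theorem powMean_pos (hp : 0 < p) (hs : s ∈ Set.Icc (0 : ℝ) 1) (ha : 0 < a) (hb : 0 < b) :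
    0 < powMean p s a b := by
  have hm : 0 < min a b := lt_min ha hb
  have h := powMean_mono hp hs hm.le hm.le (min_le_left a b) (min_le_right a b)
  rw [powMean_self hp hm.le] at h
  exact hm.trans_le h

theorem powMean_powMean (hp : 0 < p) {r t : ℝ} (hs : s ∈ Set.Icc (0 : ℝ) 1)
    (ht : t ∈ Set.Icc (0 : ℝ) 1) (ha : 0 ≤ a) (hb : 0 ≤ b) :
    powMean p r (powMean p s a b) (powMean p t a b) =
      powMean p (r * s + (1 - r) * t) a b := by
  rw [powMean, powMean_rpow hp hs ha hb, powMean_rpow hp ht ha hb, powMean]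
  congr 1
  ring

/-- The reverse Minkowski inequality for two-point means with exponent at most one. -/
theorem powMean_add_le (hp : 0 < p) (hp1 : p ≤ 1) (hs : s ∈ Set.Icc (0 : ℝ) 1) (ha : 0 < a)
    (hb : 0 < b) (hc : 0 < c) (hd : 0 < d) :
    powMean p s a b + powMean p s c d ≤ powMean p s (a + c) (b + d) := by
  have hx := powMean_pos hp hs ha hb
  have hy := powMean_pos hp hs hc hd
  have hxp := powMean_rpow hp hs ha.le hb.le
  have hyp := powMean_rpow hp hs hc.le hd.le
  set x := powMean p s a b
  set y := powMean p s c d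
  have hxy : 0 < x + y := add_pos hx hy
  have hconc : ∀ e f : ℝ, 0 ≤ e → 0 ≤ f →
      x / (x + y) * (e / x) ^ p + y / (x + y) * (f / y) ^ p ≤ ((e + f) / (x + y)) ^ p := by
    intro e f he hf
    have h := (Real.concaveOn_rpow hp.le hp1).2 (Set.mem_Ici.2 (div_nonneg he hx.le))
      (Set.mem_Ici.2 (div_nonneg hf hy.le)) (div_pos hx hxy).le (div_pos hy hxy).le (by field_simp)
    have heq : x / (x + y) * (e / x) + y / (x + y) * (f / y) = (e + f) / (x + y) := by
      field_simp
    simpa only [smul_eq_mul, heq] using h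
  have h1 := mul_le_mul_of_nonneg_left (hconc a c ha.le hc.le) hs.1
  have h2 := mul_le_mul_of_nonneg_left (hconc b d hb.le hd.le) (sub_nonneg.2 hs.2)
  simp only [Real.div_rpow, ha.le, hb.le, hc.le, hd.le, hx.le, hy.le, (add_pos ha hc).le,
    (add_pos hb hd).le, hxy.le] at h1 h2
  have hxp0 := Real.rpow_pos_of_pos hx p
  have hyp0 := Real.rpow_pos_of_pos hy p
  have hxyp0 := Real.rpow_pos_of_pos hxy p
  have key : (1 : ℝ) ≤ (s * (a + c) ^ p + (1 - s) * (b + d) ^ p) / (x + y) ^ p := by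
    calc (1 : ℝ) = x / (x + y) * ((s * a ^ p + (1 - s) * b ^ p) / x ^ p) +
          y / (x + y) * ((s * c ^ p + (1 - s) * d ^ p) / y ^ p) := by
          rw [← hxp, ← hyp, div_self hxp0.ne', div_self hyp0.ne']
          field_simp
      _ ≤ _ := by
          refine le_of_eq_of_le ?_ ((add_le_add h1 h2).trans_eq ?_) <;> ring
  rw [one_le_div hxyp0] at key
  have hfin := Real.rpow_le_rpow hxyp0.le key (one_div_nonneg.2 hp.le)
  rwa [one_div, Real.rpow_rpow_inv hxy.le hp.ne', ← one_div] at hfin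

end WeightedMean

section LpCombination

variable {n : ℕ} {p s : ℝ} {K L : Set (Euc n)} {u v w x : Euc n}

theorem mem_lpComb (hp : 0 < p) (hs : s ∈ Set.Icc (0 : ℝ) 1) (hK : IsCompact K)
    (hL : IsCompact L) (hK0 : (0 : Euc n) ∈ interior K) (hL0 : (0 : Euc n) ∈ interior L) :
    x ∈ lpComb p s K L ↔ ∀ u ≠ 0, ⟪u, x⟫ ≤ powMean p s (suppFn K u) (suppFn L u) := by
  rw [lpComb, if_neg hp.ne']
  constructor
  · intro h u hu
    have hn : 0 < ‖u‖ := norm_pos_iff.2 hu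
    have h1 := h (‖u‖⁻¹ • u) (by rw [norm_smul, norm_inv, norm_norm, inv_mul_cancel₀ hn.ne'])
    rw [suppFn_smul_s14 hK ⟨0, interior_subset hK0⟩ (inv_pos.2 hn),
      suppFn_smul_s14 hL ⟨0, interior_subset hL0⟩ (inv_pos.2 hn), ← powMean,
      powMean_smul hp hs (inv_pos.2 hn).le (suppFn_pos hK hK0 hu).le (suppFn_pos hL hL0 hu).le,
      inner_smul_right, real_inner_comm] at h1
    exact le_of_mul_le_mul_left h1 (inv_pos.2 hn)
  · intro h u hu
    rw [real_inner_comm]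
    exact h u (norm_ne_zero_iff.1 (by rw [hu]; exact one_ne_zero))

theorem convex_lpComb (hp : 0 < p) : Convex ℝ (lpComb p s K L) := by
  rw [lpComb, if_neg hp.ne', Set.ofPred_forall]
  refine convex_iInter fun u => ?_
  rw [Set.ofPred_forall]
  exact convex_iInter fun _ => convex_halfSpace_le ⟨fun x y => inner_add_left x y u,
    fun c x => real_inner_smul_left x u c⟩ _

theorem isCompact_lpComb (hp : 0 < p) (hs : s ∈ Set.Icc (0 : ℝ) 1) (hK : IsCompact K)
    (hL : IsCompact L) (hK0 : (0 : Euc n) ∈ interior K) (hL0 : (0 : Euc n) ∈ interior L) :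
    IsCompact (lpComb p s K L) := by
  refine Metric.isCompact_of_isClosed_isBounded ?_ ?_
  · rw [lpComb, if_neg hp.ne', Set.ofPred_forall]
    refine isClosed_iInter fun u => ?_
    rw [Set.ofPred_forall]
    exact isClosed_iInter fun _ => isClosed_le (by fun_prop) continuous_const
  · obtain ⟨R, hR, hKL⟩ := (hK.isBounded.union hL.isBounded).exists_pos_norm_le
    have hle : ∀ M ⊆ K ∪ L, M.Nonempty → ∀ u : Euc n, suppFn M u ≤ ‖u‖ * R :=
      fun M hM hne u => suppFn_le hne fun y hy => (real_inner_le_norm u y).trans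
        (mul_le_mul_of_nonneg_left (hKL y (hM hy)) (norm_nonneg u))
    refine isBounded_iff_forall_norm_le.2 ⟨R, fun x hx => ?_⟩
    rcases eq_or_ne x 0 with rfl | hx0
    · simpa using hR.le
    have h := (mem_lpComb hp hs hK hL hK0 hL0).1 hx x hx0
    have h2 := powMean_mono hp hs (suppFn_pos hK hK0 hx0).le (suppFn_pos hL hL0 hx0).le
      (hle K Set.subset_union_left ⟨0, interior_subset hK0⟩ x)
      (hle L Set.subset_union_right ⟨0, interior_subset hL0⟩ x)
    rw [powMean_self hp (by positivity)] at h2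
    rw [real_inner_self_eq_norm_mul_norm] at h
    exact le_of_mul_le_mul_left (h.trans h2) (norm_pos_iff.2 hx0)

theorem zero_mem_interior_lpComb (hp : 0 < p) (hs : s ∈ Set.Icc (0 : ℝ) 1) (hK : IsCompact K)
    (hL : IsCompact L) (hK0 : (0 : Euc n) ∈ interior K) (hL0 : (0 : Euc n) ∈ interior L) :
    (0 : Euc n) ∈ interior (lpComb p s K L) := by
  have h0 : (0 : Euc n) ∈ interior (K ∩ L) := by
    rw [interior_inter]
    exact ⟨hK0, hL0⟩
  refine interior_mono (fun x hx => (mem_lpComb hp hs hK hL hK0 hL0).2 fun u hu => ?_) h0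
  have hx' := le_max_left ⟪u, x⟫ 0
  refine (hx'.trans_eq (powMean_self hp (le_max_right _ _)).symm).trans
    (powMean_mono hp hs (le_max_right _ _) (le_max_right _ _) ?_ ?_)
  · exact max_le (inner_le_suppFn_s14 hK hx.1) (suppFn_pos hK hK0 hu).le
  · exact max_le (inner_le_suppFn_s14 hL hx.2) (suppFn_pos hL hL0 hu).le

theorem suppFn_lpComb_le (hp : 0 < p) (hs : s ∈ Set.Icc (0 : ℝ) 1) (hK : IsCompact K)
    (hL : IsCompact L) (hK0 : (0 : Euc n) ∈ interior K) (hL0 : (0 : Euc n) ∈ interior L)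
    (hu : u ≠ 0) : suppFn (lpComb p s K L) u ≤ powMean p s (suppFn K u) (suppFn L u) :=
  suppFn_le ⟨0, interior_subset (zero_mem_interior_lpComb hp hs hK hL hK0 hL0)⟩
    fun _ hy => (mem_lpComb hp hs hK hL hK0 hL0).1 hy u hu

theorem powMean_suppFn_add_le (hp : 0 < p) (hp1 : p ≤ 1) (hs : s ∈ Set.Icc (0 : ℝ) 1)
    (hK : IsCompact K) (hL : IsCompact L) (hK0 : (0 : Euc n) ∈ interior K)
    (hL0 : (0 : Euc n) ∈ interior L) (hv : v ≠ 0) (hw : w ≠ 0)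
    (hKvw : suppFn K (v + w) = suppFn K v + suppFn K w)
    (hLvw : suppFn L (v + w) = suppFn L v + suppFn L w) :
    powMean p s (suppFn K v) (suppFn L v) + powMean p s (suppFn K w) (suppFn L w) ≤
      powMean p s (suppFn K (v + w)) (suppFn L (v + w)) := by
  rw [hKvw, hLvw]
  exact powMean_add_le hp hp1 hs (suppFn_pos hK hK0 hv) (suppFn_pos hL hL0 hv)
    (suppFn_pos hK hK0 hw) (suppFn_pos hL hL0 hw)

open scoped Pointwise in
theorem mem_suppSet_of_add {a b : Euc n} (hK : IsCompact K) (hL : IsCompact L) (ha : a ∈ K)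
    (hb : b ∈ L) (hab : a + b ∈ suppSet (K + L) u) : a ∈ suppSet K u ∧ b ∈ suppSet L u := by
  have hmax := ((mem_suppSet_iff (hK.add hL)).1 hab).2
  refine ⟨(mem_suppSet_iff hK).2 ⟨ha, fun y hy => ?_⟩,
    (mem_suppSet_iff hL).2 ⟨hb, fun y hy => ?_⟩⟩
  · simpa [inner_add_right] using hmax (y + b) (Set.add_mem_add hy hb)
  · simpa [inner_add_right] using hmax (a + y) (Set.add_mem_add ha hy)

open scoped Pointwise in
theorem IsPolytope.add (hK : IsPolytope K) (hL : IsPolytope L) : IsPolytope (K + L) := by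
  classical
  obtain ⟨S, rfl⟩ := hK
  obtain ⟨T, rfl⟩ := hL
  exact ⟨S + T, by rw [Finset.coe_add, convexHull_add]⟩

/-- A polytope has finitely many facet normals, up to scaling. -/
theorem IsPolytope.finite_facet_normals (hK : IsPolytope K) :
    {v | suppFn K v = 1 ∧ Submodule.span ℝ (suppSet K v) = ⊤}.Finite := by
  classical
  obtain ⟨S, rfl⟩ := hK
  refine Set.Finite.of_injOn (t := S.powerset)
    (f := fun v => S.filter (· ∈ suppSet (convexHull ℝ (S : Set (Euc n))) v))
    (fun v _ => Finset.mem_coe.2 (Finset.mem_powerset.2 (Finset.filter_subset _ _))) ?_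
    (Finset.finite_toSet _)
  intro v hv w hw hvw
  have hspan := hv.2.symm.le.trans span_suppSet_le
  have heq : ∀ x : Euc n, ⟪v, x⟫ = ⟪w, x⟫ := fun x => by
    have h := inner_mul_eq_of_mem_span (u := v) (v := w) (a := 1) (b := 1)
      (fun y hy => hv.1 ▸ hy.2.2) (fun y hy => ?_) (hspan (Submodule.mem_top (x := x)))
    · simpa using h
    · have hy' : y ∈ S.filter (· ∈ suppSet (convexHull ℝ (S : Set (Euc n))) v) :=
        Finset.mem_filter.2 hy
      rw [show S.filter (· ∈ suppSet (convexHull ℝ (S : Set (Euc n))) v) =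
        S.filter (· ∈ suppSet (convexHull ℝ (S : Set (Euc n))) w) from hvw] at hy'
      exact hw.1 ▸ (Finset.mem_filter.1 hy').2.2
  exact ext_inner_right ℝ heq

open scoped Pointwise in
/-- An `L_p` combination of polytopes, `p ≤ 1`, is cut out by finitely many half-spaces. -/
theorem exists_finite_normals_lpComb (hp : 0 < p) (hp1 : p ≤ 1) (hs : s ∈ Set.Icc (0 : ℝ) 1)
    (hK : IsPolytope K) (hL : IsPolytope L) (hK0 : (0 : Euc n) ∈ interior K)
    (hL0 : (0 : Euc n) ∈ interior L) :
    ∃ N : Set (Euc n), N.Finite ∧ (∀ v ∈ N, v ≠ 0) ∧ ∀ x,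
      x ∈ lpComb p s K L ↔ ∀ v ∈ N, ⟪v, x⟫ ≤ powMean p s (suppFn K v) (suppFn L v) := by
  have hKc := hK.isCompact
  have hLc := hL.isCompact
  have hM := hK.add hL
  have hM0 : (0 : Euc n) ∈ interior (K + L) := by
    refine interior_mono (fun x hx => ?_) hK0
    exact ⟨x, hx, 0, interior_subset hL0, add_zero x⟩
  have hNne : ∀ v ∈ {v | suppFn (K + L) v = 1 ∧ Submodule.span ℝ (suppSet (K + L) v) = ⊤},
      v ≠ 0 := by
    rintro v ⟨hv, -⟩ rfl
    obtain ⟨y, hy⟩ := suppSet_nonempty hM.isCompact (nonempty_of_zero_mem_interior hM0) 0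
    rw [← hy.2, inner_zero_left] at hv
    exact zero_ne_one hv
  refine ⟨_, hM.finite_facet_normals, hNne, fun x => ?_⟩
  rw [mem_lpComb hp hs hKc hLc hK0 hL0]
  refine ⟨fun h v hv => h v (hNne v hv), fun h u hu => ?_⟩
  refine facet_induction hM hM0
    (P := fun u => ⟪u, x⟫ ≤ powMean p s (suppFn K u) (suppFn L u)) ?_ ?_ hu
  · intro v hv htop
    have hpos := suppFn_pos hM.isCompact hM0 hv
    have hMne := nonempty_of_zero_mem_interior hM0
    have h1 := h ((suppFn (K + L) v)⁻¹ • v) ⟨by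
      rw [suppFn_smul_s14 hM.isCompact hMne (inv_pos.2 hpos), inv_mul_cancel₀ hpos.ne'], by
      rw [suppSet_smul hM.isCompact (inv_pos.2 hpos), htop]⟩
    rw [suppFn_smul_s14 hKc ⟨0, interior_subset hK0⟩ (inv_pos.2 hpos),
      suppFn_smul_s14 hLc ⟨0, interior_subset hL0⟩ (inv_pos.2 hpos),
      powMean_smul hp hs (inv_pos.2 hpos).le (suppFn_pos hKc hK0 hv).le
        (suppFn_pos hLc hL0 hv).le, real_inner_smul_left] at h1
    exact le_of_mul_le_mul_left h1 (inv_pos.2 hpos)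
  · intro v w hv hw hvw hsubv hsubw hPv hPw
    rw [inner_add_left]
    obtain ⟨y, hy⟩ := suppSet_nonempty hM.isCompact (nonempty_of_zero_mem_interior hM0) (v + w)
    obtain ⟨a, ha, b, hb, rfl⟩ := hy.1
    have hab := fun z (hz : a + b ∈ suppSet (K + L) z) => mem_suppSet_of_add hKc hLc ha hb hz
    obtain ⟨hav, hbv⟩ := hab v (hsubv hy)
    obtain ⟨haw, hbw⟩ := hab w (hsubw hy)
    obtain ⟨havw, hbvw⟩ := hab _ hy
    exact (add_le_add hPv hPw).trans <| powMean_suppFn_add_le hp hp1 hs hKc hLc hK0 hL0 hv hw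
      (suppFn_add_of_mem hav haw havw) (suppFn_add_of_mem hbv hbw hbvw)

theorem isPolytope_lpComb (hp : 0 < p) (hp1 : p ≤ 1) (hs : s ∈ Set.Icc (0 : ℝ) 1)
    (hK : IsPolytope K) (hL : IsPolytope L) (hK0 : (0 : Euc n) ∈ interior K)
    (hL0 : (0 : Euc n) ∈ interior L) : IsPolytope (lpComb p s K L) := by
  classical
  have hc := isCompact_lpComb hp hs hK.isCompact hL.isCompact hK0 hL0
  obtain ⟨N, hN, -, hmem⟩ := exists_finite_normals_lpComb hp hp1 hs hK hL hK0 hL0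
  have hfin : (Set.extremePoints ℝ (lpComb p s K L)).Finite := by
    refine Set.Finite.of_injOn
      (f := fun x => {v ∈ N | ⟪v, x⟫ = powMean p s (suppFn K v) (suppFn L v)})
      (t := 𝒫 N) (fun x _ => Set.sep_subset _ _) ?_ hN.finite_subsets
    intro x hx y hy hxy
    have hactive : ∀ v ∈ N, ⟪v, x⟫ = powMean p s (suppFn K v) (suppFn L v) → ⟪v, y⟫ = ⟪v, x⟫ :=
      fun v hv h => ((Set.ext_iff.1 hxy v).1 ⟨hv, h⟩).2.trans h.symm
    have hev : ∀ᶠ ε in nhdsWithin (0 : ℝ) (Set.Ioi 0), ∀ v ∈ N,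
        ⟪v, x + ε • (x - y)⟫ ≤ powMean p s (suppFn K v) (suppFn L v) := by
      refine (Filter.eventually_all_finite hN).2 fun v hv => ?_
      rcases ((hmem x).1 hx.1 v hv).eq_or_lt with h | h
      · refine Filter.Eventually.of_forall fun ε => ?_
        rw [inner_add_right, inner_smul_right, inner_sub_right, hactive v hv h, h]
        simp
      · have hcont : Continuous fun ε : ℝ => ⟪v, x + ε • (x - y)⟫ := by fun_prop
        have := (hcont.tendsto 0).eventually_lt_const (by simpa using h)
        filter_upwards [this.filter_mono nhdsWithin_le_nhds] with ε hε using hε.le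
    obtain ⟨ε, hε, hεpos⟩ := (hev.and self_mem_nhdsWithin).exists
    refine ((mem_extremePoints.1 hx).2 y hy.1 _ ((hmem _).2 hε)
      ⟨ε / (1 + ε), 1 / (1 + ε), by positivity, by positivity, by field_simp; ring, ?_⟩).1.symm
    match_scalars <;> field_simp <;> ring
  refine ⟨hfin.toFinset, ?_⟩
  rw [hfin.coe_toFinset, ← (hfin.isClosed_convexHull ℝ).closure_eq,
    closure_convexHull_extremePoints hc (convex_lpComb hp)]

/-- The defining constraint of an `L_p` combination is attained at every facet normal. -/
theorem suppFn_lpComb_eq (hp : 0 < p) (hp1 : p ≤ 1) (hs : s ∈ Set.Icc (0 : ℝ) 1)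
    (hK : IsPolytope K) (hL : IsPolytope L) (hK0 : (0 : Euc n) ∈ interior K)
    (hL0 : (0 : Euc n) ∈ interior L) (hu : u ≠ 0)
    (htop : Submodule.span ℝ (suppSet (lpComb p s K L) u) = ⊤) :
    suppFn (lpComb p s K L) u = powMean p s (suppFn K u) (suppFn L u) := by
  classical
  have hKc := hK.isCompact
  have hLc := hL.isCompact
  have hc := isCompact_lpComb hp hs hKc hLc hK0 hL0
  have hpos := suppFn_pos hc (zero_mem_interior_lpComb hp hs hKc hLc hK0 hL0) hu
  obtain ⟨N, hN, hN0, hmem⟩ := exists_finite_normals_lpComb hp hp1 hs hK hL hK0 hL0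
  obtain ⟨S, hS⟩ := isPolytope_lpComb hp hp1 hs hK hL hK0 hL0
  have hcvx : Convex ℝ (lpComb p s K L) := convex_lpComb hp
  have hspan : (⊤ : Submodule ℝ (Euc n)) ≤
      Submodule.span ℝ {y | y ∈ S ∧ y ∈ suppSet (lpComb p s K L) u} := by
    rw [← htop, hS]
    exact span_suppSet_le
  set Q := lpComb p s K L
  set T := S.filter (· ∈ suppSet Q u) with hT
  have hTmem : ∀ y, y ∈ T ↔ y ∈ S ∧ y ∈ suppSet Q u := fun y => Finset.mem_filter
  have hTne : T.Nonempty := by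
    by_contra hemp
    rw [Finset.not_nonempty_iff_eq_empty] at hemp
    have hemp' : {y | y ∈ S ∧ y ∈ suppSet Q u} = ∅ :=
      Set.eq_empty_of_forall_notMem fun y hy => by
        have := (hTmem y).2 hy
        simp [hemp] at this
    rw [hemp', Submodule.span_empty] at hspan
    exact hu (by simpa using hspan (Submodule.mem_top (x := u)))
  have hcard : (0 : ℝ) < T.card := Nat.cast_pos.2 hTne.card_pos
  set z : Euc n := ∑ y ∈ T, (T.card : ℝ)⁻¹ • y with hz
  have hzF : z ∈ suppSet Q u := (convex_suppSet hcvx u).sum_mem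
    (fun _ _ => (inv_pos.2 hcard).le) (by simp [hcard.ne']) fun y hy => ((hTmem y).1 hy).2
  obtain ⟨w, hw, hzw⟩ : ∃ w ∈ N, ⟪w, z⟫ = powMean p s (suppFn K w) (suppFn L w) := by
    by_contra! hcon
    have hev : ∀ᶠ ε in nhdsWithin (0 : ℝ) (Set.Ioi 0), ∀ v ∈ N,
        ⟪v, z + ε • z⟫ ≤ powMean p s (suppFn K v) (suppFn L v) := by
      refine (Filter.eventually_all_finite hN).2 fun v hv => ?_
      have hcont : Continuous fun ε : ℝ => ⟪v, z + ε • z⟫ := by fun_prop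
      have := (hcont.tendsto 0).eventually_lt_const
        (by simpa using ((hmem z).1 hzF.1 v hv).lt_of_ne (hcon v hv))
      filter_upwards [this.filter_mono nhdsWithin_le_nhds] with ε hε using hε.le
    obtain ⟨ε, hε, hεpos⟩ := (hev.and self_mem_nhdsWithin).exists
    have h := inner_le_suppFn_s14 (u := u) hc ((hmem _).2 hε)
    rw [inner_add_right, inner_smul_right, hzF.2] at h
    have := mul_pos (Set.mem_Ioi.1 hεpos) hpos
    linarith
  have hle : ∀ y ∈ T, (T.card : ℝ)⁻¹ * ⟪w, y⟫ ≤ (T.card : ℝ)⁻¹ * ⟪w, z⟫ := fun y hy =>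
    mul_le_mul_of_nonneg_left (hzw ▸ (hmem y).1 ((hTmem y).1 hy).2.1 w hw) (inv_pos.2 hcard).le
  have hsum : ∑ y ∈ T, (T.card : ℝ)⁻¹ * ⟪w, y⟫ = ∑ y ∈ T, (T.card : ℝ)⁻¹ * ⟪w, z⟫ := by
    rw [Finset.sum_const, nsmul_eq_mul, mul_inv_cancel_left₀ hcard.ne']
    conv_rhs => rw [hz, inner_sum]
    simp only [inner_smul_right]
  have hall := (Finset.sum_eq_sum_iff_of_le hle).1 hsum
  have hwT : ∀ y ∈ {y | y ∈ S ∧ y ∈ suppSet Q u}, ⟪w, y⟫ = ⟪w, z⟫ := fun y hy =>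
    mul_left_cancel₀ (inv_pos.2 hcard).ne' (hall y ((hTmem y).2 hy))
  have hzpos : 0 < ⟪w, z⟫ := hzw ▸ powMean_pos hp hs (suppFn_pos hKc hK0 (hN0 w hw))
    (suppFn_pos hLc hL0 (hN0 w hw))
  have hscale : (⟪w, z⟫ / suppFn Q u) • u = w := by
    refine ext_inner_right ℝ fun x => ?_
    have h := inner_mul_eq_of_mem_span (fun y hy => hy.2.2) hwT (hspan (Submodule.mem_top (x := x)))
    rw [real_inner_smul_left, div_mul_eq_mul_div, h, mul_div_cancel_left₀ _ hpos.ne']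
  have hcpos : 0 < ⟪w, z⟫ / suppFn Q u := div_pos hzpos hpos
  have hfin : powMean p s (suppFn K w) (suppFn L w) =
      ⟪w, z⟫ / suppFn Q u * powMean p s (suppFn K u) (suppFn L u) := by
    conv_lhs => rw [← hscale]
    rw [suppFn_smul_s14 hKc ⟨0, interior_subset hK0⟩ hcpos,
      suppFn_smul_s14 hLc ⟨0, interior_subset hL0⟩ hcpos,
      powMean_smul hp hs hcpos.le (suppFn_pos hKc hK0 hu).le (suppFn_pos hLc hL0 hu).le]
  rw [← hzw, div_mul_eq_mul_div, eq_div_iff hpos.ne'] at hfin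
  exact mul_left_cancel₀ hzpos.ne' hfin

end LpCombination

/-- Lemma 3.3: with `K_s = (1-s)·K +_p s·L`, if `λ = (1-γ)α + γβ` and `K_α, K_λ, K_β`
are pairwise strongly isomorphic, then `K_λ = (1-γ)·K_α +_p γ·K_β`. -/
theorem lpComb_of_stronglyIsomorphic (n : ℕ) (p : ℝ) (hp0 : 0 < p) (hp1 : p ≤ 1)
    (K L : Set (Euc n)) (hK : IsPolytope K) (hL : IsPolytope L)
    (hK0 : (0 : Euc n) ∈ interior K) (hL0 : (0 : Euc n) ∈ interior L)
    (α β γ lam : ℝ) (hα : α ∈ Set.Icc (0:ℝ) 1) (hβ : β ∈ Set.Icc (0:ℝ) 1)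
    (hγ : γ ∈ Set.Icc (0:ℝ) 1) (hlam : lam = (1 - γ) * α + γ * β)
    (hiso₁ : StronglyIsomorphic (lpComb p (1 - α) K L) (lpComb p (1 - lam) K L))
    (hiso₂ : StronglyIsomorphic (lpComb p (1 - α) K L) (lpComb p (1 - β) K L))
    (hiso₃ : StronglyIsomorphic (lpComb p (1 - lam) K L) (lpComb p (1 - β) K L)) :
    lpComb p (1 - lam) K L
      = lpComb p (1 - γ) (lpComb p (1 - α) K L) (lpComb p (1 - β) K L) := by
  have hKc := hK.isCompact
  have hLc := hL.isCompact
  have hα' : 1 - α ∈ Set.Icc (0 : ℝ) 1 := Set.Icc.mem_iff_one_sub_mem.1 hα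
  have hβ' : 1 - β ∈ Set.Icc (0 : ℝ) 1 := Set.Icc.mem_iff_one_sub_mem.1 hβ
  have hγ' : 1 - γ ∈ Set.Icc (0 : ℝ) 1 := Set.Icc.mem_iff_one_sub_mem.1 hγ
  have hl : 1 - lam = (1 - γ) * (1 - α) + (1 - (1 - γ)) * (1 - β) := by rw [hlam]; ring
  have hl' : 1 - lam ∈ Set.Icc (0 : ℝ) 1 := by
    rw [hl]
    exact convex_Icc (0 : ℝ) 1 hα' hβ' hγ'.1 (by linarith [hγ.1]) (by ring)
  have hA := isPolytope_lpComb hp0 hp1 hα' hK hL hK0 hL0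
  have hB := isPolytope_lpComb hp0 hp1 hβ' hK hL hK0 hL0
  have hA0 := zero_mem_interior_lpComb hp0 hα' hKc hLc hK0 hL0
  have hB0 := zero_mem_interior_lpComb hp0 hβ' hKc hLc hK0 hL0
  have hdim := fun u (hu : u ≠ 0) => hiso₂.affDim_eq hA.isCompact hB.isCompact hu
  have hmean : ∀ u ≠ 0, powMean p (1 - γ) (powMean p (1 - α) (suppFn K u) (suppFn L u))
      (powMean p (1 - β) (suppFn K u) (suppFn L u)) =
        powMean p (1 - lam) (suppFn K u) (suppFn L u) := fun u hu => by
    rw [powMean_powMean hp0 hα' hβ' (suppFn_pos hKc hK0 hu).le (suppFn_pos hLc hL0 hu).le, ← hl]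
  ext x
  rw [mem_lpComb hp0 hl' hKc hLc hK0 hL0,
    mem_lpComb hp0 hγ' hA.isCompact hB.isCompact hA0 hB0]
  constructor
  · intro hx u hu
    refine facet_induction hA hA0 (P := fun u => ⟪u, x⟫ ≤ powMean p (1 - γ)
      (suppFn (lpComb p (1 - α) K L) u) (suppFn (lpComb p (1 - β) K L) u)) ?_ ?_ hu
    · intro v hv htop
      have hAne := suppSet_nonempty hA.isCompact (nonempty_of_zero_mem_interior hA0) v
      have hBne := suppSet_nonempty hB.isCompact (nonempty_of_zero_mem_interior hB0) v
      have htopB : Submodule.span ℝ (suppSet (lpComb p (1 - β) K L) v) = ⊤ := by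
        apply Submodule.eq_top_of_finrank_eq
        rw [finrank_span_suppSet hBne (suppFn_pos hB.isCompact hB0 hv), ← hdim v hv,
          ← finrank_span_suppSet hAne (suppFn_pos hA.isCompact hA0 hv), htop, finrank_top]
      rw [suppFn_lpComb_eq hp0 hp1 hα' hK hL hK0 hL0 hv htop,
        suppFn_lpComb_eq hp0 hp1 hβ' hK hL hK0 hL0 hv htopB, hmean v hv]
      exact hx v hv
    · intro v w hv hw hvw hsubv hsubw hPv hPw
      rw [inner_add_left]
      obtain ⟨a, ha⟩ := suppSet_nonempty hA.isCompact (nonempty_of_zero_mem_interior hA0) (v + w)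
      obtain ⟨b, hb⟩ := suppSet_nonempty hB.isCompact (nonempty_of_zero_mem_interior hB0) (v + w)
      have hbv := StronglyIsomorphic.suppSet_add_subset_left hA.isCompact hA0 hB hB0 hdim hv hw
        hsubv hsubw hb
      have hbw := StronglyIsomorphic.suppSet_add_subset_left hA.isCompact hA0 hB hB0 hdim hw hv
        (add_comm v w ▸ hsubw) (add_comm v w ▸ hsubv) (add_comm v w ▸ hb)
      exact (add_le_add hPv hPw).trans <| powMean_suppFn_add_le hp0 hp1 hγ' hA.isCompact
        hB.isCompact hA0 hB0 hv hw (suppFn_add_of_mem (hsubv ha) (hsubw ha) ha)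
        (suppFn_add_of_mem hbv hbw hb)
  · intro hx u hu
    rw [← hmean u hu]
    exact (hx u hu).trans <| powMean_mono hp0 hγ' (suppFn_pos hA.isCompact hA0 hu).le
      (suppFn_pos hB.isCompact hB0 hu).le (suppFn_lpComb_le hp0 hα' hKc hLc hK0 hL0 hu)
      (suppFn_lpComb_le hp0 hβ' hKc hLc hK0 hL0 hu)

end
end
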